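/- Let U = U₁U₂ and V = V₁V₂ be irreducible words such that the word UV is freely reduced and rs(U,V) = (U₂,V₁). If nf(U₂V₁) = X b₁b₂⋯b_s with 2 ≤ s ≤ 2g for some b₁⋯b_{4g} ∈ 𝓡 and some word X, then V₂ does not begin with the letter b_{s+1}. Symmetrically, if nf(U₂V₁) = b_s⋯b₂b₁X for some b₁⋯b_{4g} ∈ 𝓡 and some word X, then U₁ does not end with the letter b_{s+1}. -/

import Mathlib

namespace SG

/-- A letter of the alphabet `S± = {cᵢ^{±1}}`: `(i, true)` is `c_{i+1}`,
`(i, false)` is `c_{i+1}⁻¹`. -/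
abbrev Letter (g : ℕ) := Fin (2*g) × Bool

/-- A word in the alphabet `S±`. -/
abbrev Word (g : ℕ) := List (Letter g)

/-- The surface relator `c₁c₂⋯c_{2g}c₁⁻¹c₂⁻¹⋯c_{2g}⁻¹` in the free group. -/
def relator (g : ℕ) : FreeGroup (Fin (2*g)) :=
  (List.ofFn fun i : Fin (2*g) => FreeGroup.of i).prod *
  (List.ofFn fun i : Fin (2*g) => (FreeGroup.of i)⁻¹).prod

/-- The surface group with the symmetric presentation. -/
abbrev SurfaceGroup (g : ℕ) :=
  PresentedGroup ({relator g} : Set (FreeGroup (Fin (2*g))))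

/-- The generator `c_{i+1}` of the surface group. -/
def gen (g : ℕ) (i : Fin (2*g)) : SurfaceGroup g := PresentedGroup.of i

/-- The inverse of a letter. -/
def invLetter (g : ℕ) (a : Letter g) : Letter g := (a.1, !a.2)

/-- The group element represented by a letter. -/
def evalLetter (g : ℕ) (a : Letter g) : SurfaceGroup g :=
  if a.2 then gen g a.1 else (gen g a.1)⁻¹

/-- The group element represented by a word. -/
def eval (g : ℕ) (W : Word g) : SurfaceGroup g := (W.map (evalLetter g)).prod

/-- The formal inverse `x_n⁻¹ ⋯ x₁⁻¹` of a word `x₁ ⋯ x_n`. -/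
def wordInv (g : ℕ) (W : Word g) : Word g := (W.map (invLetter g)).reverse

/-- Word length of a group element: the least `n` such that the element is a
product of `n` elements of `S ∪ S⁻¹`. -/
noncomputable def len (g : ℕ) (u : SurfaceGroup g) : ℕ :=
  sInf {n | ∃ W : Word g, W.length = n ∧ eval g W = u}

/-- `conjLen g u v` is the minimum of `|x|` over conjugators `x` with `x⁻¹ux = v`. -/
noncomputable def conjLen (g : ℕ) (u v : SurfaceGroup g) : ℕ :=
  sInf {k | ∃ x : SurfaceGroup g, x⁻¹ * u * x = v ∧ len g x = k}

/-- The conjugator length function: `CL g n` is the least `N` such that any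
conjugate `u, v` with `|u| + |v| ≤ n` admit a conjugator of length `≤ N`. -/
noncomputable def CL (g : ℕ) (n : ℕ) : ℕ :=
  sInf {N | ∀ u v : SurfaceGroup g,
    (∃ x : SurfaceGroup g, x⁻¹ * u * x = v) → len g u + len g v ≤ n →
      conjLen g u v ≤ N}

/-- Rank of a letter in the ascending order
`c_{2g} ≺ ⋯ ≺ c₂ ≺ c₁ ≺ c₁⁻¹ ≺ c₂⁻¹ ≺ ⋯ ≺ c_{2g}⁻¹`. -/
def rank (g : ℕ) (a : Letter g) : ℕ :=
  if a.2 then (2*g - 1) - (a.1 : ℕ) else 2*g + (a.1 : ℕ)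

/-- The strict order `≺` on letters. -/
def letterLt (g : ℕ) (a b : Letter g) : Prop := rank g a < rank g b

/-- The length-lexicographical order `≺` on words. -/
def wordLt (g : ℕ) (X Y : Word g) : Prop :=
  X.length < Y.length ∨ (X.length = Y.length ∧ List.Lex (letterLt g) X Y)

/-- A word is irreducible if it is the `≺`-least word representing its element. -/
def IrreducibleWord (g : ℕ) (W : Word g) : Prop :=
  ∀ W' : Word g, eval g W' = eval g W → W' = W ∨ wordLt g W W'

/-- A word is cyclically irreducible if all its cyclic permutations are irreducible. -/
def CyclicallyIrreducibleWord (g : ℕ) (W : Word g) : Prop :=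
  ∀ W' : Word g, List.IsRotated W W' → IrreducibleWord g W'

/-- A word is freely reduced if no letter is followed by its inverse. -/
def FreelyReduced (g : ℕ) (W : Word g) : Prop :=
  List.Chain' (fun a c => c ≠ invLetter g a) W

/-- The normal form of a group element: the `≺`-least word representing it. -/
noncomputable def nf (g : ℕ) (x : SurfaceGroup g) : Word g := by
  classical
  exact if h : ∃ W : Word g, eval g W = x ∧ IrreducibleWord g W then h.choose else []

/-- The word `R = c₁c₂⋯c_{2g}c₁⁻¹c₂⁻¹⋯c_{2g}⁻¹`. -/
def Rword (g : ℕ) : Word g :=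
  (List.ofFn fun i : Fin (2*g) => ((i, true) : Letter g)) ++
  (List.ofFn fun i : Fin (2*g) => ((i, false) : Letter g))

/-- `𝓡`: all cyclic permutations of `R` and of `R⁻¹`. -/
def RSet (g : ℕ) : Set (Word g) :=
  {W | List.IsRotated (Rword g) W ∨ List.IsRotated (wordInv g (Rword g)) W}

/-- `seg g b i k` is the word `b_i b_{i+1} ⋯ b_{i+k-1}`. -/
def seg (g : ℕ) (b : ℕ → Letter g) (i k : ℕ) : Word g :=
  (List.range k).map fun j => b (i + j)

/-- `dseg g b i k` is the descending word `b_i b_{i-1} ⋯ b_{i-k+1}`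
(indices taken modulo `4g`, using periodicity of `b`). -/
def dseg (g : ℕ) (b : ℕ → Letter g) (i k : ℕ) : Word g :=
  (List.range k).map fun j => b (i + 4*g - j)

/-- `b : ℕ → Letter g` is a `4g`-periodic (1-based) enumeration of the letters
`b₁, …, b_{4g}` of some word `b₁⋯b_{4g} ∈ 𝓡`. -/
def RelSeq (g : ℕ) (b : ℕ → Letter g) : Prop :=
  (∀ i, b (i + 4*g) = b i) ∧ seg g b 1 (4*g) ∈ RSet g

/-- The `t`-th power `W^t` of a word. -/
def wpow (g : ℕ) (W : Word g) (t : ℕ) : Word g := (List.replicate t W).flatten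

/-- A `k`-fractional relator: an initial segment of length `k` (with `2 ≤ k ≤ 4g`)
of some word in `𝓡`. -/
def IsFR (g : ℕ) (k : ℕ) (W : Word g) : Prop :=
  2 ≤ k ∧ k ≤ 4*g ∧ ∃ B ∈ RSet g, W = B.take k

/-- `IsLLFROcc g k W P F Q` : the factorization `W = P ++ F ++ Q` exhibits `F`
as a `k`-locally longest fractional relator of `W`. -/
def IsLLFROcc (g : ℕ) (k : ℕ) (W P F Q : Word g) : Prop :=
  W = P ++ F ++ Q ∧ IsFR g k F ∧
  (∀ a, P.getLast? = some a → ¬ IsFR g (k+1) (a :: F)) ∧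
  (∀ a, Q.head? = some a → ¬ IsFR g (k+1) (F ++ [a]))

/-- `W` contains a `k`-LLFR. -/
def HasLLFR (g : ℕ) (k : ℕ) (W : Word g) : Prop :=
  ∃ P F Q, IsLLFROcc g k W P F Q

/-- Length-lexicographical order on pairs of words. -/
def pairLt (g : ℕ) (p q : Word g × Word g) : Prop :=
  wordLt g p.1 q.1 ∨ (p.1 = q.1 ∧ wordLt g p.2 q.2)

/-- A candidate for the reducing-subword pair of `(W₁, W₂)`. -/
def IsRSCand (g : ℕ) (W₁ W₂ C₁ C₂ : Word g) : Prop :=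
  ∃ A B C' : Word g, W₁ = A ++ C₁ ∧ W₂ = C₂ ++ B ∧
    nf g (eval g (W₁ ++ W₂)) = A ++ C' ++ B

/-- `(C₁, C₂)` is the reducing-subword pair `rs(W₁, W₂)`: the `≺`-least candidate. -/
def IsRS (g : ℕ) (W₁ W₂ C₁ C₂ : Word g) : Prop :=
  IsRSCand g W₁ W₂ C₁ C₂ ∧
  ∀ D₁ D₂ : Word g, IsRSCand g W₁ W₂ D₁ D₂ →
    (C₁ = D₁ ∧ C₂ = D₂) ∨ pairLt g (C₁, C₂) (D₁, D₂)

end SG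


namespace SGP
open CoxeterSystem
variable {B W : Type*} [Group W] {M : CoxeterMatrix B} (cs : CoxeterSystem M W)

open Classical in
/-- The sign permutation attached to a simple reflection. -/
noncomputable def flipFun (i : B) (p : W × ZMod 2) : W × ZMod 2 :=
  (cs.simple i * p.1 * cs.simple i, p.2 + if p.1 = cs.simple i then 1 else 0)

lemma z2 (x : ZMod 2) : x + x = 0 := CharTwo.add_self_eq_zero x

open Classical in
lemma flipFun_mk (i : B) (t : W) (e : ZMod 2) : flipFun cs i (t, e) =
    (cs.simple i * t * cs.simple i, e + if t = cs.simple i then 1 else 0) := rfl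

lemma flipFun_flipFun (i : B) (p : W × ZMod 2) : flipFun cs i (flipFun cs i p) = p := by
  have h : ∀ t : W, cs.simple i * t * cs.simple i = cs.simple i ↔ t = cs.simple i := by
    intro t
    constructor
    · intro h
      have h2 : cs.simple i * t = 1 := by simpa using h
      have h3 := eq_inv_of_mul_eq_one_right h2
      simpa using h3
    · rintro rfl; simp
  obtain ⟨t, e⟩ := p
  rw [flipFun_mk, flipFun_mk]
  refine Prod.ext ?_ ?_
  · simp [mul_assoc]
  · by_cases ht : t = cs.simple i
    · have := (h t).2 ht
      rw [if_pos this, if_pos ht, add_assoc, z2, add_zero]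
    · have := (h t).not.2 ht
      rw [if_neg this, if_neg ht, add_zero, add_zero]

/-- The sign permutation attached to a simple reflection, as a permutation. -/
noncomputable def flip (i : B) : Equiv.Perm (W × ZMod 2) :=
  ⟨flipFun cs i, flipFun cs i, flipFun_flipFun cs i, flipFun_flipFun cs i⟩

lemma flip_apply (i : B) (p : W × ZMod 2) : flip cs i p = flipFun cs i p := rfl

lemma simple_conj_pow (i j : B) (m : ℕ) :
    cs.simple j * (cs.simple i * cs.simple j) ^ m =
      ((cs.simple i * cs.simple j) ^ m)⁻¹ * cs.simple j := by
  induction m with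
  | zero => simp
  | succ m ih =>
    rw [pow_succ, ← mul_assoc, ih, mul_inv_rev]
    have hc : (cs.simple i * cs.simple j)⁻¹ = cs.simple j * cs.simple i := by simp
    have hcomm : Commute ((cs.simple i * cs.simple j) ^ m)⁻¹ (cs.simple i * cs.simple j)⁻¹ :=
      (((Commute.refl _).pow_left m).inv_inv)
    rw [← hcomm.eq, hc]
    simp [mul_assoc]

open Classical in
lemma flip_pow (i j : B) (m : ℕ) (t : W) (e : ZMod 2) :
    ((flip cs i * flip cs j) ^ m) (t, e) =
      ((cs.simple i * cs.simple j) ^ m * t * ((cs.simple i * cs.simple j) ^ m)⁻¹,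
        e + ∑ l ∈ Finset.range (2 * m),
          if t = ((cs.simple i * cs.simple j) ^ l)⁻¹ * cs.simple j then 1 else 0) := by
  induction m with
  | zero => simp
  | succ m ih =>
    rw [pow_succ', Equiv.Perm.mul_apply, ih, Equiv.Perm.mul_apply, flip_apply, flip_apply]
    set c := cs.simple i * cs.simple j with hc
    have hci : c⁻¹ = cs.simple j * cs.simple i := by simp [hc]
    have h1 : c ^ m * t * (c ^ m)⁻¹ = cs.simple j ↔ t = (c ^ (2 * m))⁻¹ * cs.simple j := by
      have := simple_conj_pow cs i j m
      rw [← hc] at this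
      rw [two_mul, pow_add, mul_inv_rev, mul_assoc ((c ^ m)⁻¹), ← this]
      constructor
      · intro h; rw [← h]; group
      · rintro h; rw [h]; group
    have h2 : cs.simple j * (c ^ m * t * (c ^ m)⁻¹) * cs.simple j = cs.simple i ↔
        t = (c ^ (2 * m + 1))⁻¹ * cs.simple j := by
      have := simple_conj_pow cs i j m
      rw [← hc] at this
      have e1 : (c ^ (2 * m + 1))⁻¹ * cs.simple j
          = (c ^ m)⁻¹ * (c⁻¹ * cs.simple j) * c ^ m := by
        have : (c ^ m)⁻¹ * (c⁻¹ * cs.simple j) * c ^ m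
          = (c ^ m)⁻¹ * c⁻¹ * (cs.simple j * c ^ m) := by group
        rw [this, ‹cs.simple j * c ^ m = _›, ← mul_assoc]
        congr 1
        rw [← inv_pow, ← inv_pow, ← pow_succ, ← pow_add]
        congr 1; ring
      rw [e1, hci]
      constructor
      · intro h; rw [← h]; simp [mul_assoc]
      · rintro h; rw [h]; simp [mul_assoc]
    simp only [flipFun]
    rw [show 2 * (m + 1) = 2 * m + 1 + 1 by ring, Finset.sum_range_succ, Finset.sum_range_succ]
    simp only [h1, h2]
    refine Prod.ext ?_ ?_
    · simp only [pow_succ' c m, mul_inv_rev, hci]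
      simp only [hc, mul_assoc]
    · simp only [add_assoc]

lemma flip_liftable : M.IsLiftable (flip cs) := by
  classical
  intro i j
  apply Equiv.ext
  rintro ⟨t, e⟩
  rw [flip_pow]
  have h := cs.simple_mul_simple_pow i j
  refine Prod.ext ?_ ?_
  · simp [h]
  · rw [two_mul, Finset.sum_range_add]
    simp only [pow_add, h, one_mul, z2]
    simp

/-- The sign representation. -/
noncomputable def signRep : W →* Equiv.Perm (W × ZMod 2) := cs.lift ⟨flip cs, flip_liftable cs⟩

/-- Separation indicator: `eta w t = 1` iff the reflection `t` separates `1` from `w`. -/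
noncomputable def eta (w t : W) : ZMod 2 := (signRep cs w⁻¹ (t, 0)).2

lemma signRep_simple (i : B) : signRep cs (cs.simple i) = flip cs i :=
  cs.lift_apply_simple _ i

lemma signRep_apply (w t : W) (e : ZMod 2) :
    signRep cs w (t, e) = (w * t * w⁻¹, e + eta cs w⁻¹ t) := by
  unfold eta
  rw [inv_inv]
  induction w using cs.simple_induction_left generalizing e with
  | one => simp
  | mul_simple_left w i ih =>
    rw [map_mul, signRep_simple, Equiv.Perm.mul_apply, Equiv.Perm.mul_apply, ih, ih]
    simp only [flip_apply, flipFun]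
    refine Prod.ext ?_ ?_
    · simp [mul_assoc]
    · simp [add_assoc]

lemma eta_one (t : W) : eta cs 1 t = 0 := by simp [eta]

open Classical in
lemma eta_simple (i : B) (t : W) : eta cs (cs.simple i) t = if t = cs.simple i then 1 else 0 := by
  simp [eta, signRep_simple, flip_apply, flipFun]

lemma eta_mul (w w' t : W) : eta cs (w * w') t = eta cs w t + eta cs w' (w⁻¹ * t * w) := by
  conv_lhs => rw [eta, mul_inv_rev, map_mul, Equiv.Perm.mul_apply, signRep_apply, signRep_apply]
  simp

lemma eta_inv (w t : W) : eta cs w⁻¹ t = eta cs w (w * t * w⁻¹) := by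
  have h := eta_mul cs w w⁻¹ (w * t * w⁻¹)
  have h2 : w⁻¹ * (w * t * w⁻¹) * w = t := by group
  rw [mul_inv_cancel, eta_one, h2] at h
  have := z2 (eta cs w⁻¹ t)
  have h3 : eta cs w (w * t * w⁻¹) = - eta cs w⁻¹ t := by linear_combination -h
  rw [h3, CharTwo.neg_eq]

open Classical in
lemma eta_wordProd (ω : List B) (t : W) :
    eta cs (cs.wordProd ω) t = ((cs.leftInvSeq ω).count t : ZMod 2) := by
  induction ω generalizing t with
  | nil => simp [eta_one]
  | cons i ω ih =>
    rw [cs.wordProd_cons, eta_mul, eta_simple, ih, leftInvSeq, List.count_cons]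
    have h : (cs.simple i)⁻¹ * t * cs.simple i = MulAut.conj (cs.simple i) t := by simp
    have h2 : MulAut.conj (cs.simple i) (MulAut.conj (cs.simple i) t) = t := by
      simp [mul_assoc]
    have h3 : List.count (MulAut.conj (cs.simple i) t) (cs.leftInvSeq ω) =
      List.count t ((cs.leftInvSeq ω).map (MulAut.conj (cs.simple i))) := by
      conv_rhs => rw [← h2]
      rw [List.count_map_of_injective _ _ (MulAut.conj (cs.simple i)).injective]
    rw [h, h3]
    push_cast
    rw [add_comm]
    congr 1
    by_cases hh : t = cs.simple i
    · simp [hh]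
    · simp [hh, Ne.symm hh]

lemma eta_iff_mem {ω : List B} (hω : cs.IsReduced ω) (t : W) :
    eta cs (cs.wordProd ω) t = 1 ↔ t ∈ cs.leftInvSeq ω := by
  classical
  rw [eta_wordProd]
  by_cases h : t ∈ cs.leftInvSeq ω
  · rw [List.count_eq_one_of_mem hω.nodup_leftInvSeq h]; simp [h]
  · rw [List.count_eq_zero_of_not_mem h]; simp [h]

lemma z2_cases (x : ZMod 2) : x = 0 ∨ x = 1 := by
  revert x; decide

lemma z2_ne {x : ZMod 2} : ¬ x = 1 ↔ x = 0 := by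
  revert x; decide

lemma length_lt_of_eta {w t : W} (h : eta cs w t = 1) : cs.length (t * w) < cs.length w := by
  obtain ⟨ω, hω, rfl⟩ := cs.exists_isReduced w
  rw [eta_iff_mem cs hω] at h
  exact (cs.isLeftInversion_of_mem_leftInvSeq hω h).2

lemma eta_simple_iff (w : W) (i : B) :
    eta cs w (cs.simple i) = 1 ↔ cs.length (cs.simple i * w) < cs.length w := by
  refine ⟨length_lt_of_eta cs, fun h => ?_⟩
  by_contra h2
  rw [z2_ne] at h2
  have h3 : eta cs (cs.simple i * w) (cs.simple i) = 1 := by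
    rw [eta_mul, eta_simple]; simp [h2]
  have := length_lt_of_eta cs h3
  simp at this
  omega

lemma eta_simple_mul_self (w : W) (i : B) :
    eta cs (cs.simple i * w) (cs.simple i) = 1 + eta cs w (cs.simple i) := by
  rw [eta_mul, eta_simple]; simp

lemma eta_simple_mul_of_ne (w t : W) (i : B) (h : t ≠ cs.simple i) :
    eta cs (cs.simple i * w) t = eta cs w (cs.simple i * t * cs.simple i) := by
  rw [eta_mul, eta_simple]; simp [h]

lemma eq_one_of_eta {w : W} (h : ∀ i, eta cs w (cs.simple i) = 0) : w = 1 := by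
  by_contra hw
  obtain ⟨i, hi⟩ := cs.exists_leftDescent_of_ne_one hw
  have := (eta_simple_iff cs w i).2 hi
  rw [h i] at this
  exact absurd this (by decide)

/-- Every element factors as a dihedral word times an element with no dihedral inversions, the
word being of minimal length. -/
lemma dihedral_decomp (w : W) (i j : B) :
    ∃ (ω : List B) (z : W), w = cs.wordProd ω * z ∧ (∀ c ∈ ω, c = i ∨ c = j) ∧
      (∀ τ : List B, (∀ c ∈ τ, c = i ∨ c = j) → eta cs z (cs.wordProd τ) = 0) ∧
      (∀ τ : List B, (∀ c ∈ τ, c = i ∨ c = j) → cs.wordProd τ = cs.wordProd ω →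
        ω.length ≤ τ.length) := by
  classical
  let P : ℕ → Prop := fun n => ∃ τ : List B, (∀ c ∈ τ, c = i ∨ c = j) ∧
    cs.length ((cs.wordProd τ)⁻¹ * w) = n
  have hP : ∃ n, P n := ⟨_, [], by simp, rfl⟩
  obtain ⟨τ, hτ, hn⟩ := Nat.find_spec hP
  let Q : ℕ → Prop := fun n => ∃ σ : List B, (∀ c ∈ σ, c = i ∨ c = j) ∧
    cs.wordProd σ = cs.wordProd τ ∧ σ.length = n
  have hQ : ∃ n, Q n := ⟨_, τ, hτ, rfl, rfl⟩
  obtain ⟨ω, hω, hωτ, hωn⟩ := Nat.find_spec hQ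
  refine ⟨ω, (cs.wordProd τ)⁻¹ * w, by rw [hωτ]; group, hω, ?_, ?_⟩
  · intro σ hσ
    by_contra hne
    rw [← z2_ne, not_not] at hne
    have h1 := length_lt_of_eta cs hne
    have : Nat.find hP ≤ _ := Nat.find_min' hP ⟨τ ++ σ.reverse, by
      intro c hc
      rcases List.mem_append.1 hc with h | h
      · exact hτ c h
      · exact hσ c (List.mem_reverse.1 h), rfl⟩
    rw [← hn] at this
    simp only [cs.wordProd_append, cs.wordProd_reverse, mul_inv_rev, inv_inv, mul_assoc] at this h1
    omega
  · intro σ hσ hh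
    rw [hωn]
    exact Nat.find_min' hQ ⟨σ, hσ, hh.trans hωτ, rfl⟩

lemma eta_head_of_minimal {i j c : B} {ω : List B}
    (hω : ∀ c' ∈ c :: ω, c' = i ∨ c' = j)
    (hmin : ∀ τ : List B, (∀ c' ∈ τ, c' = i ∨ c' = j) → cs.wordProd τ = cs.wordProd (c :: ω) →
        (c :: ω).length ≤ τ.length) :
    eta cs (cs.wordProd (c :: ω)) (cs.simple c) = 1 := by
  rw [cs.wordProd_cons, eta_simple_mul_self]
  by_contra hne
  have h1 : eta cs (cs.wordProd ω) (cs.simple c) = 1 := by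
    rcases z2_cases (eta cs (cs.wordProd ω) (cs.simple c)) with h | h
    · rw [h] at hne; simp at hne
    · exact h
  classical
  rw [eta_wordProd] at h1
  have hmem : cs.simple c ∈ cs.leftInvSeq ω := by
    by_contra h
    rw [List.count_eq_zero_of_not_mem h] at h1
    simp at h1
  obtain ⟨n, hn, hnc⟩ := List.mem_iff_getElem.1 hmem
  have h2 := cs.getD_leftInvSeq_mul_wordProd ω n
  rw [List.getD_eq_getElem _ _ hn, hnc, ← cs.wordProd_cons] at h2
  have hn' : n < ω.length := by simpa using hn
  have h3 := hmin (ω.eraseIdx n) (fun c' hc' =>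
    hω c' (List.mem_cons_of_mem _ (List.mem_of_mem_eraseIdx hc'))) h2.symm
  rw [List.length_eraseIdx] at h3
  simp [hn'] at h3
  omega

lemma dihedral_no_inversion {w : W} {i j : B} (hi : eta cs w (cs.simple i) = 0)
    (hj : eta cs w (cs.simple j) = 0) (τ : List B) (hτ : ∀ c ∈ τ, c = i ∨ c = j) :
    eta cs w (cs.wordProd τ) = 0 := by
  obtain ⟨ω, z, rfl, hω, hz, hmin⟩ := dihedral_decomp cs w i j
  rcases ω with _ | ⟨c, ω⟩
  · simpa using hz τ hτ
  · exfalso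
    have h1 := eta_head_of_minimal cs hω hmin
    have h2 : eta cs (cs.wordProd (c :: ω) * z) (cs.simple c) = 1 := by
      rw [eta_mul, h1]
      have : (cs.wordProd (c :: ω))⁻¹ * cs.simple c * cs.wordProd (c :: ω)
          = cs.wordProd ((c :: ω).reverse ++ [c] ++ (c :: ω)) := by
        rw [cs.wordProd_append, cs.wordProd_append, cs.wordProd_reverse, cs.wordProd_singleton]
      rw [this, hz _ (by
        intro c' hc'
        apply hω
        simp at hc' ⊢
        tauto)]
      simp
    rcases hω c (by simp) with rfl | rfl
    · rw [hi] at h2; exact absurd h2 (by decide)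
    · rw [hj] at h2; exact absurd h2 (by decide)

lemma eta_braid {w : W} {i j : B} (hij : cs.simple i ≠ cs.simple j)
    (hi : eta cs w (cs.simple i) = 1)
    (hj : eta cs w (cs.simple j) = 1) :
    eta cs w (cs.simple i * cs.simple j * cs.simple i) = 1 := by
  by_contra hne
  rw [z2_ne] at hne
  have h1 : eta cs (cs.simple i * w) (cs.simple i) = 0 := by
    rw [eta_simple_mul_self, hi]; exact z2 1
  have h2 : eta cs (cs.simple i * w) (cs.simple j) = 0 := by
    rw [eta_simple_mul_of_ne cs _ _ _ hij.symm, hne]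
  have h3 := dihedral_no_inversion cs h1 h2 [i, j, i] (by simp)
  have h4 : eta cs w (cs.simple j) = 0 := by
    rw [eta_simple_mul_of_ne] at h3
    · simpa [wordProd, mul_assoc] using h3
    · intro h
      simp only [wordProd, List.map_cons, List.map_nil, List.prod_cons, List.prod_nil,
        mul_one] at h
      have h5 := mul_left_cancel (h.trans (mul_one _).symm)
      have h6 := eq_inv_of_mul_eq_one_left h5
      simp at h6
      exact hij h6.symm
  rw [hj] at h4
  exact absurd h4 (by decide)

end SGP


namespace SGP
open CoxeterSystem

section
variable {B W : Type*} [Group W] {M : CoxeterMatrix B} (cs : CoxeterSystem M W)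

lemma alt_kappa {i j : B} (ρ : W →* Equiv.Perm ℤ)
    (hi : ∀ x, ρ (cs.simple i) x = -x) (hj : ∀ x, ρ (cs.simple j) x = 1 - x) (ω : List B)
    (hω : ∀ c ∈ ω, c = i ∨ c = j)
    (hmin : ∀ τ : List B, (∀ c ∈ τ, c = i ∨ c = j) → cs.wordProd τ = cs.wordProd ω →
        ω.length ≤ τ.length) (t : W) (ht : t ∈ cs.leftInvSeq ω) :
    ∃ κ : ℤ, (∀ x, ρ t x = κ - x) ∧ (ω.head? = some i → κ ≤ 0) ∧ (ω.head? = some j → 1 ≤ κ) := by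
  have hij : i ≠ j := by
    rintro rfl
    have := (hi 0).symm.trans (hj 0)
    simp at this
  induction ω generalizing t with
  | nil => simp at ht
  | cons c ω ih =>
    have hω' : ∀ c ∈ ω, c = i ∨ c = j := fun c hc => hω c (List.mem_cons_of_mem _ hc)
    have hmin' : ∀ τ : List B, (∀ c ∈ τ, c = i ∨ c = j) → cs.wordProd τ = cs.wordProd ω →
        ω.length ≤ τ.length := by
      intro τ hτ h
      have := hmin (c :: τ) (by
        intro c' hc'
        rcases List.mem_cons.1 hc' with rfl | h
        · exact hω _ (by simp)
        · exact hτ _ h) (by rw [cs.wordProd_cons, cs.wordProd_cons, h])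
      simpa using this
    have hhead : ω.head? ≠ some c := by
      intro h
      rcases ω with _ | ⟨d, ω⟩
      · simp at h
      · simp at h
        subst h
        have := hmin ω (fun c hc => hω' c (List.mem_cons_of_mem _ hc)) (by
          simp [cs.wordProd_cons])
        simp at this
    rw [leftInvSeq, List.mem_cons, List.mem_map] at ht
    rcases ht with rfl | ⟨t, ht, rfl⟩
    · rcases hω c (by simp) with rfl | rfl
      · exact ⟨0, by simp [hi], by simp, by simp [hij]⟩
      · exact ⟨1, by simp [hj], by simp [hij.symm], by simp⟩
    · obtain ⟨κ, h1, h2, h3⟩ := ih hω' hmin' t ht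
      obtain ⟨d, hd⟩ : ∃ d, ω.head? = some d := by
        rcases ω with _ | ⟨d, ω⟩
        · simp at ht
        · exact ⟨d, rfl⟩
      have hdm : d = i ∨ d = j := hω' d (List.mem_of_mem_head? hd)
      rw [hd] at hhead h2 h3
      have hdc : d ≠ c := by simpa using hhead
      rcases hω c (by simp) with rfl | rfl
      · have hdj : d = j := by tauto
        have := h3 (by rw [hdj])
        refine ⟨-κ, ?_, ?_, ?_⟩
        · intro x
          simp [hi, h1]; ring
        · intro _; omega
        · simp [hij]
      · have hdi : d = i := by tauto
        have := h2 (by rw [hdi])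
        refine ⟨2 - κ, ?_, ?_, ?_⟩
        · intro x
          simp [hj, h1]; ring
        · simp [hij.symm]
        · intro _; omega

lemma not_both_of_rho {i j : B} (ρ : W →* Equiv.Perm ℤ)
    (hi : ∀ x, ρ (cs.simple i) x = -x) (hj : ∀ x, ρ (cs.simple j) x = 1 - x) (w : W)
    (h1 : eta cs w (cs.simple i) = 1) (h2 : eta cs w (cs.simple j) = 1) : False := by
  obtain ⟨ω, z, rfl, hω, hz, hmin⟩ := dihedral_decomp cs w i j
  have key : ∀ c, (c = i ∨ c = j) → eta cs (cs.wordProd ω * z) (cs.simple c) = 1 →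
      cs.simple c ∈ cs.leftInvSeq ω := by
    intro c hc h
    rw [eta_mul] at h
    have : (cs.wordProd ω)⁻¹ * cs.simple c * cs.wordProd ω
          = cs.wordProd (ω.reverse ++ [c] ++ ω) := by
      rw [cs.wordProd_append, cs.wordProd_append, cs.wordProd_reverse, cs.wordProd_singleton]
    rw [this, hz _ (by
        intro c' hc'
        simp at hc'
        rcases hc' with h | rfl | h
        · exact hω _ h
        · exact hc
        · exact hω _ h), add_zero] at h
    classical
    rw [eta_wordProd] at h
    by_contra h'
    rw [List.count_eq_zero_of_not_mem h'] at h
    simp at h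
  have m1 := key i (Or.inl rfl) h1
  have m2 := key j (Or.inr rfl) h2
  obtain ⟨κ, a1, a2, a3⟩ := alt_kappa cs ρ hi hj ω hω hmin _ m1
  obtain ⟨κ', b1, b2, b3⟩ := alt_kappa cs ρ hi hj ω hω hmin _ m2
  have e1 : κ = 0 := by have := (a1 0).symm.trans (hi 0); simpa using this
  have e2 : κ' = 1 := by have := (b1 0).symm.trans (hj 0); simpa using this
  obtain ⟨d, hd⟩ : ∃ d, ω.head? = some d := by
    rcases ω with _ | ⟨d, ω⟩
    · simp at m1
    · exact ⟨d, rfl⟩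
  rcases hω d (List.mem_of_mem_head? hd) with rfl | rfl
  · have := b2 hd; omega
  · have := a3 hd; omega

end

/-- The Coxeter matrix of the reflection group of the right polygon. -/
def cmat (g : ℕ) : CoxeterMatrix (ZMod (4 * g)) where
  M := Matrix.of fun i j => if i = j then 1 else if j = i + 1 ∨ i = j + 1 then 2 * g else 0
  isSymm := by
    ext i j
    simp only [Matrix.transpose_apply, Matrix.of_apply]
    by_cases h : i = j
    · simp [h]
    · simp [h, Ne.symm h, or_comm]
  diagonal := by intro i; simp
  off_diagonal := by
    intro i j h
    simp only [Matrix.of_apply, h, if_false]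
    split_ifs <;> omega

lemma cmat_apply (g : ℕ) (i j : ZMod (4 * g)) :
    cmat g i j = if i = j then 1 else if j = i + 1 ∨ i = j + 1 then 2 * g else 0 := rfl

lemma liftable_of {g : ℕ} {G : Type*} [Monoid G] (f : ZMod (4 * g) → G)
    (h1 : ∀ i, f i * f i = 1)
    (h2 : ∀ i j, i ≠ j → j = i + 1 ∨ i = j + 1 → (f i * f j) ^ (2 * g) = 1) :
    (cmat g).IsLiftable f := by
  intro i j
  rw [cmat_apply]
  split_ifs with h h'
  · subst h; rw [h1]; simp
  · exact h2 i j h h'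
  · simp

/-- The Coxeter system. -/
abbrev csys (g : ℕ) : CoxeterSystem (cmat g) (cmat g).Group := (cmat g).toCoxeterSystem

lemma simple_ne {g : ℕ} {i j : ZMod (4 * g)} (hij : i ≠ j) :
    (csys g).simple i ≠ (csys g).simple j := by
  classical
  let f : ZMod (4 * g) → Multiplicative (ZMod 2) := fun k =>
    if k = i then Multiplicative.ofAdd 1 else 1
  have hsq : ∀ x : Multiplicative (ZMod 2), x * x = 1 := by decide
  have hf : (cmat g).IsLiftable f := liftable_of f (fun i => hsq _) (fun a b _ _ => by
    rw [pow_mul, pow_two, hsq, one_pow])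
  intro h
  have h2 := congrArg ((csys g).lift ⟨f, hf⟩) h
  rw [lift_apply_simple, lift_apply_simple] at h2
  simp only [f, if_true, if_neg hij.symm] at h2
  exact absurd h2 (by decide)

lemma not_both {g : ℕ} {i j : ZMod (4 * g)} (hij : i ≠ j) (h1 : j ≠ i + 1) (h2 : i ≠ j + 1)
    (w : (cmat g).Group)
    (hi : eta (csys g) w ((csys g).simple i) = 1) (hj : eta (csys g) w ((csys g).simple j) = 1) :
    False := by
  classical
  let f : ZMod (4 * g) → Equiv.Perm ℤ := fun k =>
    if k = i then Equiv.neg ℤ else if k = j then Equiv.subLeft 1 else 1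
  have hsq : ∀ k, f k * f k = 1 := by
    intro k
    ext x
    simp only [f]
    split_ifs <;> simp
  have hf : (cmat g).IsLiftable f := liftable_of f hsq (fun a b hne hab => by
    have : f a = 1 ∨ f b = 1 := by
      simp only [f]
      by_contra hc
      push Not at hc
      obtain ⟨c1, c2⟩ := hc
      split_ifs at c1 c2 <;> simp_all
    rcases this with h | h
    · rw [h, one_mul, pow_mul, pow_two, hsq, one_pow]
    · rw [h, mul_one, pow_mul, pow_two, hsq, one_pow])
  refine not_both_of_rho (csys g) ((csys g).lift ⟨f, hf⟩) ?_ ?_ w hi hj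
  · intro x
    rw [lift_apply_simple]
    simp [f]
  · intro x
    rw [lift_apply_simple]
    simp [f, hij.symm]

end SGP


namespace SGP
open CoxeterSystem

lemma eta_head {g : ℕ} {c : ZMod (4 * g)} {ω : List (ZMod (4 * g))}
    (h : (csys g).IsReduced (c :: ω)) :
    eta (csys g) ((csys g).wordProd ω) ((csys g).simple c) = 0 := by
  have hω : (csys g).IsReduced ω := h.drop 1
  rw [← z2_ne, eta_simple_iff, ← wordProd_cons]
  have h1 := h.eq
  have h2 := hω.eq
  rw [h1, h2]
  simp

lemma zmod_ne_zero {g : ℕ} (hg : 2 ≤ g) (k : ℕ) (hk : 0 < k) (hk8 : k < 8) :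
    (k : ZMod (4 * g)) ≠ 0 := by
  rw [ne_eq, ZMod.natCast_eq_zero_iff]
  intro h
  have := Nat.le_of_dvd hk h
  omega

lemma core_W {g : ℕ} (hg : 2 ≤ g) {ε i j : ZMod (4 * g)} (hε : ε = 1 ∨ ε = -1)
    (hi : i = j + ε) (C₀ U V : List (ZMod (4 * g)))
    (hC : (csys g).IsReduced (C₀ ++ [i, j, i])) (hU : (csys g).IsReduced U)
    (hV : (csys g).IsReduced (V ++ [i]))
    (hmul : (csys g).wordProd U * (csys g).wordProd V = (csys g).wordProd (C₀ ++ [i, j]))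
    (hlast : V.getLast? ≠ some j) :
    ∃ k, (csys g).wordProd (U.take k) = (csys g).wordProd (C₀ ++ [i]) := by
  classical
  set cs := csys g with hcs
  have n1 : (1 : ZMod (4 * g)) ≠ 0 := by simpa using zmod_ne_zero hg 1 (by norm_num) (by norm_num)
  have n2 : (2 : ZMod (4 * g)) ≠ 0 := by simpa using zmod_ne_zero hg 2 (by norm_num) (by norm_num)
  have n3 : (3 : ZMod (4 * g)) ≠ 0 := by simpa using zmod_ne_zero hg 3 (by norm_num) (by norm_num)
  have n4 : (4 : ZMod (4 * g)) ≠ 0 := by simpa using zmod_ne_zero hg 4 (by norm_num) (by norm_num)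
  have n5 : (5 : ZMod (4 * g)) ≠ 0 := by simpa using zmod_ne_zero hg 5 (by norm_num) (by norm_num)
  have hij : i ≠ j := by
    rw [hi]; intro h
    rcases hε with rfl | rfl
    · exact n1 (by linear_combination h)
    · exact n1 (by linear_combination -h)
  have hsij : cs.simple i ≠ cs.simple j := simple_ne hij
  have z01 : ¬ (0 : ZMod 2) = 1 := by decide
  -- adjacency
  have adj : ∀ (w : (cmat g).Group) (a b : ZMod (4 * g)), eta cs w (cs.simple a) = 1 →
      eta cs w (cs.simple b) = 1 → b = a ∨ b = a + ε ∨ b = a - ε := by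
    intro w a b ha hb
    by_contra hc
    push Not at hc
    obtain ⟨c1, c2, c3⟩ := hc
    refine not_both (i := a) (j := b) c1.symm ?_ ?_ w ha hb
    · rcases hε with rfl | rfl
      · exact c2
      · intro h; apply c3; rw [h]; ring
    · rcases hε with rfl | rfl
      · intro h; apply c3; rw [h]; ring
      · intro h; apply c2; rw [h]; ring
  set x := cs.wordProd (C₀ ++ [i]) with hx
  have hxinv : x⁻¹ = cs.wordProd (i :: C₀.reverse) := by
    rw [hx, ← cs.wordProd_reverse]; simp
  -- facts at x⁻¹
  have hCr : cs.IsReduced (i :: j :: i :: C₀.reverse) := by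
    have := hC.reverse
    simpa using this
  have q1 : eta cs x⁻¹ (cs.simple i) = 1 := by
    have := eta_head (hCr.drop 2)
    rw [hxinv, wordProd_cons, eta_simple_mul_self, this, add_zero]
  have q2 : eta cs x⁻¹ (cs.simple j) = 0 := by
    rw [hxinv]; exact eta_head (hCr.drop 1)
  have q3 : eta cs x⁻¹ (cs.simple j * cs.simple i * cs.simple j) = 0 := by
    have := eta_head hCr
    rw [wordProd_cons, eta_simple_mul_of_ne _ _ _ _ hsij] at this
    rw [hxinv]; exact this
  set m := cs.wordProd U with hm
  have hp : cs.wordProd (C₀ ++ [i, j]) = x * cs.simple j := by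
    rw [hx, ← cs.wordProd_singleton, ← wordProd_append]; simp
  have hVinv : cs.wordProd V.reverse = cs.simple j * (x⁻¹ * m) := by
    rw [cs.wordProd_reverse, eq_comm, eq_inv_iff_mul_eq_one]
    rw [hp] at hmul
    rw [mul_assoc, mul_assoc, hmul]; simp
  have hVr : cs.IsReduced (i :: V.reverse) := by
    have := hV.reverse
    simpa using this
  have v1 : eta cs (cs.simple j * (x⁻¹ * m)) (cs.simple i) = 0 := by
    rw [← hVinv]; exact eta_head hVr
  have m3 : eta cs (x⁻¹ * m) (cs.simple j * cs.simple i * cs.simple j) = 0 := by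
    rwa [eta_simple_mul_of_ne _ _ _ _ hsij] at v1
  have Qsub : ∀ a, eta cs x⁻¹ (cs.simple a) = 1 → a = j + ε ∨ a = j + 2 * ε := by
    intro a ha
    rcases adj _ _ _ q1 ha with h | h | h
    · left; rw [h, hi]
    · right; rw [h, hi]; ring
    · exfalso
      have : a = j := by rw [h, hi]; ring
      rw [this, q2] at ha
      exact z01 ha
  have Msub : ∀ b, eta cs (x⁻¹ * m) (cs.simple b) = 1 →
      b = j ∨ b = j - ε ∨ b = j - 2 * ε := by
    intro b hb
    rcases z2_cases (eta cs (x⁻¹ * m) (cs.simple j)) with h0 | h1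
    · have hl : ∃ l, l ≠ j ∧ cs.IsReduced V.reverse ∧ V.reverse.head? = some l := by
        rcases hlr : V.reverse with _ | ⟨l, t⟩
        · exfalso
          rw [hlr] at hVinv
          have : x⁻¹ * m = cs.simple j := by
            have := hVinv.symm
            rw [wordProd_nil] at this
            simpa using (eq_inv_of_mul_eq_one_right this)
          rw [this, eta_simple] at h0
          simp at h0
        · refine ⟨l, ?_, ?_, rfl⟩
          · rintro rfl
            apply hlast
            rw [← List.head?_reverse, hlr]; rfl
          · rw [← hlr]; exact hVr.drop 1
      obtain ⟨l, hlj, hred, hhead⟩ := hl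
      have el : eta cs (cs.simple j * (x⁻¹ * m)) (cs.simple l) = 1 := by
        rw [← hVinv]
        rcases hlr : V.reverse with _ | ⟨l', t⟩
        · rw [hlr] at hhead; simp at hhead
        · rw [hlr] at hhead hred
          simp at hhead
          subst hhead
          rw [wordProd_cons, eta_simple_mul_self, eta_head hred, add_zero]
      have ej : eta cs (cs.simple j * (x⁻¹ * m)) (cs.simple j) = 1 := by
        rw [eta_simple_mul_self, h0, add_zero]
      have hlε : l = j - ε := by
        rcases adj _ _ _ ej el with h | h | h
        · exact absurd h hlj
        · rw [h, ← hi, v1] at el; exact absurd el z01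
        · exact h
      have hlM : eta cs (x⁻¹ * m) (cs.simple l) = 1 := by
        have := eta_braid cs (simple_ne hlj.symm) ej el
        rw [eta_simple_mul_of_ne] at this
        · simpa [mul_assoc] using this
        · intro h
          have h5 : cs.simple j * cs.simple l = 1 := by
            have := congrArg (· * cs.simple j) h
            simpa using this
          have h6 := eq_inv_of_mul_eq_one_left h5
          rw [inv_simple] at h6
          exact simple_ne hlj.symm h6
      rcases adj _ _ _ hlM hb with h | h | h
      · right; left; rw [h, hlε]
      · left; rw [h, hlε]; ring
      · right; right; rw [h, hlε]; ring
    · rcases adj _ _ _ h1 hb with h | h | h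
      · left; exact h
      · exfalso
        rw [h, ← hi] at hb
        have := eta_braid cs hsij.symm h1 hb
        rw [m3] at this
        exact z01 this
      · right; left; exact h
  have A : ∀ a b, eta cs x⁻¹ (cs.simple a) = 1 → eta cs (x⁻¹ * m) (cs.simple b) = 1 →
      a ≠ b ∧ ((a = i ∧ b = j) ∨ (b ≠ a + ε ∧ b ≠ a - ε)) := by
    intro a b ha hb
    have hh : ∀ k : ZMod (4 * g), k ≠ 0 → k * ε ≠ 0 := by
      intro k hk
      rcases hε with rfl | rfl <;> simpa using hk
    have e1 := hh _ n1
    have e2 := hh _ n2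
    have e3 := hh _ n3
    have e4 := hh _ n4
    have e5 := hh _ n5
    rcases Qsub a ha with rfl | rfl <;> rcases Msub b hb with rfl | rfl | rfl
    · exact ⟨fun h => e1 (by linear_combination h), Or.inl ⟨hi.symm, rfl⟩⟩
    · exact ⟨fun h => e2 (by linear_combination h), Or.inr ⟨fun h => e3 (by linear_combination -h),
        fun h => e1 (by linear_combination -h)⟩⟩
    · exact ⟨fun h => e3 (by linear_combination h), Or.inr ⟨fun h => e4 (by linear_combination -h),
        fun h => e2 (by linear_combination -h)⟩⟩
    · exact ⟨fun h => e2 (by linear_combination h), Or.inr ⟨fun h => e3 (by linear_combination -h),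
        fun h => e1 (by linear_combination -h)⟩⟩
    · exact ⟨fun h => e3 (by linear_combination h), Or.inr ⟨fun h => e4 (by linear_combination -h),
        fun h => e2 (by linear_combination -h)⟩⟩
    · exact ⟨fun h => e4 (by linear_combination h), Or.inr ⟨fun h => e5 (by linear_combination -h),
        fun h => e3 (by linear_combination -h)⟩⟩
  -- the path
  let y : ℕ → (cmat g).Group := fun k => x⁻¹ * cs.wordProd (U.take k)
  let L := cs.leftInvSeq U
  have hy : ∀ k t, eta cs (y k) t = eta cs x⁻¹ t +
      (if x * t * x⁻¹ ∈ L.take k then 1 else 0) := by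
    intro k t
    simp only [y, L]
    rw [eta_mul, inv_inv]
    congr 1
    rw [← leftInvSeq_take]
    have := eta_iff_mem cs (hU.take k) (x * t * x⁻¹)
    split_ifs with h
    · exact this.2 h
    · exact z2_ne.1 (this.not.2 h)
  have hyend : y U.length = x⁻¹ * m := by simp [y, hm]
  have mono : ∀ k t, x * t * x⁻¹ ∈ L.take k → x * t * x⁻¹ ∈ L.take U.length := by
    intro k t h
    have : L.length = U.length := by simp [L]
    rw [← this, List.take_length]
    exact List.mem_of_mem_take h
  have stay : ∀ t, eta cs x⁻¹ t = 0 → eta cs (x⁻¹ * m) t = 0 → ∀ k, eta cs (y k) t = 0 := by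
    intro t h1 h2 k
    rw [hy, h1, zero_add, if_neg]
    intro h
    rw [← hyend, hy, h1, zero_add, if_pos (mono k t h)] at h2
    exact absurd h2 (by decide)
  have hex : ∃ k, ∀ a, eta cs x⁻¹ (cs.simple a) = 1 → eta cs (y k) (cs.simple a) = 0 := by
    refine ⟨U.length, fun a ha => ?_⟩
    rw [hyend, ← z2_ne]
    intro hb
    exact (A a a ha hb).1 rfl
  refine ⟨Nat.find hex, ?_⟩
  have hspec := Nat.find_spec hex
  obtain ⟨k, hk⟩ : ∃ k, Nat.find hex = k + 1 := by
    apply Nat.exists_eq_succ_of_ne_zero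
    intro h0
    rw [h0] at hspec
    have := hspec i q1
    simp only [y, List.take_zero, wordProd_nil, mul_one] at this
    rw [q1] at this
    exact absurd this (by decide)
  have hk' := Nat.find_min hex (m := k) (by omega)
  rw [hk] at hspec ⊢
  push Not at hk'
  obtain ⟨a, ha, hak⟩ := hk'
  have hak1 : eta cs (y k) (cs.simple a) = 1 := (z2_cases _).resolve_left hak
  have hfin : y (k + 1) = 1 := by
    apply eq_one_of_eta cs
    intro c
    rcases z2_cases (eta cs x⁻¹ (cs.simple c)) with hc | hc
    swap
    · exact hspec c hc
    rcases z2_cases (eta cs (x⁻¹ * m) (cs.simple c)) with hc2 | hc2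
    · exact stay _ hc hc2 _
    obtain ⟨hac, hor⟩ := A a c ha hc2
    rw [← z2_ne]
    intro h1
    rw [hy, hc, zero_add] at h1
    have h1' : x * cs.simple c * x⁻¹ ∈ L.take (k + 1) := by
      by_contra h; rw [if_neg h] at h1; exact z01 h1
    have h2 := hspec a ha
    rw [hy, ha] at h2
    have h2' : x * cs.simple a * x⁻¹ ∈ L.take (k + 1) := by
      by_contra h; rw [if_neg h] at h2; exact absurd h2 (by decide)
    have h3 : x * cs.simple a * x⁻¹ ∉ L.take k := by
      intro h; rw [hy, ha, if_pos h] at hak1; exact absurd hak1 (by decide)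
    by_cases h4 : x * cs.simple c * x⁻¹ ∈ L.take k
    · have hck1 : eta cs (y k) (cs.simple c) = 1 := by
        rw [hy, hc, if_pos h4, zero_add]
      rcases hor with ⟨rfl, rfl⟩ | ⟨h5, h6⟩
      · have := eta_braid cs hsij.symm hck1 hak1
        rw [stay _ q3 m3] at this
        exact z01 this
      · rcases adj _ _ _ hak1 hck1 with h | h | h
        · exact hac h.symm
        · exact h5 h
        · exact h6 h
    · rw [List.take_add_one, List.mem_append] at h1' h2'
      have g1 := h1'.resolve_left h4
      have g2 := h2'.resolve_left h3
      rw [Option.mem_toList] at g1 g2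
      have := Option.mem_unique g1 g2
      have h7 : cs.simple c = cs.simple a := by simpa using this
      exact simple_ne hac h7.symm
  have := hfin
  simp only [y] at this
  exact (inv_mul_eq_one.1 this).symm

end SGP


namespace SGP
open CoxeterSystem SG

/-- The element `2g` of `ZMod (4g)`. -/
def hf (g : ℕ) : ZMod (4 * g) := 2 * (g : ZMod (4 * g))

/-- The multiplier `2g+1`. -/
def kap (g : ℕ) : ZMod (4 * g) := hf g + 1

lemma hf2 (g : ℕ) : hf g + hf g = 0 := by
  have := ZMod.natCast_self (4 * g)
  push_cast at this
  unfold hf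
  linear_combination this

lemma hf_even (g : ℕ) (x : ZMod (4 * g)) : 2 * x * hf g = 0 := by
  linear_combination x * hf2 g

lemma hfsq (g : ℕ) : hf g * hf g = 0 := by
  have := hf_even g (g : ZMod (4 * g))
  conv_lhs => enter [1]; rw [hf]
  exact this

lemma kapsq (g : ℕ) : kap g * kap g = 1 := by
  unfold kap
  linear_combination hfsq g + hf2 g

/-- Position of a letter around a vertex. -/
def pos {g : ℕ} (a : Letter g) : ZMod (4 * g) :=
  ((a.1 : ℕ) : ZMod (4 * g)) * kap g + if a.2 then 0 else hf g

lemma pos_inv {g : ℕ} (a : Letter g) : pos (invLetter g a) = pos a + hf g := by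
  obtain ⟨i, e⟩ := a
  cases e
  · simp only [pos, invLetter]; simp; linear_combination -hf2 g
  · simp [pos, invLetter]

lemma pos_inj {g : ℕ} : Function.Injective (pos : Letter g → ZMod (4 * g)) := by
  have key : ∀ a : Letter g, pos a * kap g =
      (((a.1 : ℕ) + if a.2 then 0 else 2 * g : ℕ) : ZMod (4 * g)) := by
    rintro ⟨i, e⟩
    cases e
    · simp only [pos]
      simp
      change _ = (i : ZMod (4 * g)) + hf g
      have := kapsq g
      have h2 : hf g * kap g = hf g := by unfold kap; linear_combination hfsq g
      linear_combination (i : ZMod (4 * g)) * this + h2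
    · simp only [pos]
      simp
      rw [mul_assoc, kapsq, mul_one]
  intro a b h
  have h1 := key a
  rw [h, key b] at h1
  have hb := (ZMod.natCast_eq_natCast_iff' _ _ _).1 h1
  obtain ⟨i, e⟩ := a
  obtain ⟨j, e'⟩ := b
  have hi := i.2
  have hj := j.2
  rw [Nat.mod_eq_of_lt (by simp only; split_ifs <;> omega),
    Nat.mod_eq_of_lt (by simp only; split_ifs <;> omega)] at hb
  simp only at hb
  cases e <;> cases e' <;> simp at hb ⊢ <;> omega

lemma pos_bij {g : ℕ} (hg : 2 ≤ g) : Function.Bijective (pos : Letter g → ZMod (4 * g)) := by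
  have : NeZero (4 * g) := ⟨by omega⟩
  rw [Fintype.bijective_iff_injective_and_card]
  refine ⟨pos_inj, ?_⟩
  simp [ZMod.card]
  ring

lemma Rword_map_pos (g : ℕ) :
    (Rword g).map pos = (List.range (4 * g)).map fun k : ℕ => (k : ZMod (4 * g)) * kap g := by
  apply List.ext_getElem
  · simp [Rword]; ring
  · intro k h1 h2
    simp only [Rword, List.map_append, List.getElem_append, List.getElem_map, List.getElem_range,
      List.length_map, List.length_ofFn, List.getElem_ofFn]
    split_ifs with h
    · simp [pos]
    · simp [pos]
      push_cast [Nat.cast_sub (show 2 * g ≤ k by omega)]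
      change ((k : ZMod (4 * g)) - hf g) * kap g + hf g = _
      have h2 : hf g * kap g = hf g := by unfold kap; linear_combination hfsq g
      linear_combination -h2

lemma evalLetter_inv (g : ℕ) (a : Letter g) :
    evalLetter g (invLetter g a) = (evalLetter g a)⁻¹ := by
  obtain ⟨i, e⟩ := a
  cases e <;> simp [evalLetter, invLetter]

lemma eval_nil (g : ℕ) : eval g [] = 1 := rfl

lemma eval_cons (g : ℕ) (a : Letter g) (u : Word g) :
    eval g (a :: u) = evalLetter g a * eval g u := by simp [eval]

lemma eval_append (g : ℕ) (u v : Word g) : eval g (u ++ v) = eval g u * eval g v := by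
  simp [eval]

lemma eval_Rword (g : ℕ) : eval g (Rword g) = 1 := by
  have h : (PresentedGroup.mk ({relator g} : Set (FreeGroup (Fin (2*g))))) (relator g) = 1 :=
    PresentedGroup.one_of_mem (by simp)
  have h' : (PresentedGroup.mk ({relator g} : Set (FreeGroup (Fin (2*g)))))
    ((List.ofFn fun i : Fin (2*g) => FreeGroup.of i).prod *
      (List.ofFn fun i : Fin (2*g) => (FreeGroup.of i)⁻¹).prod) = 1 := h
  rw [map_mul, map_list_prod, map_list_prod] at h'
  rw [← h', Rword, eval_append]
  simp only [eval, List.map_ofFn]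
  congr 2

/-- Invariance of foldings under the relation of the surface group. -/
lemma G_inv {g : ℕ} {X : Type*} (step : ZMod (4 * g) → X → X)
    (h1 : ∀ a x, step (a + hf g) (step a x) = x)
    (h2 : ∀ x, (List.range (4 * g)).foldl (fun (x : X) (k : ℕ) => step ((k : ZMod (4 * g)) * kap g) x) x = x)
    (u v : Word g) (huv : eval g u = eval g v) (x : X) :
    u.foldl (fun x a => step (pos a) x) x = v.foldl (fun x a => step (pos a) x) x := by
  let P : Letter g → Equiv.Perm X := fun a => ⟨step (pos a), step (pos a + hf g), h1 _, fun x => by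
    have := h1 (pos a + hf g) x
    rwa [show pos a + hf g + hf g = pos a by linear_combination hf2 g] at this⟩
  have hPinv : ∀ a, P (invLetter g a) = (P a)⁻¹ := by
    intro a
    ext x
    change step (pos (invLetter g a)) x = step (pos a + hf g) x
    rw [pos_inv]
  have hfold : ∀ (w : Word g) (x : X),
      (w.map (fun a => MulOpposite.op (P a))).prod.unop x =
        w.foldl (fun x a => step (pos a) x) x := by
    intro w
    induction w with
    | nil => intro x; simp
    | cons a w ih =>
      intro x
      simp only [List.map_cons, List.prod_cons, MulOpposite.unop_mul, MulOpposite.unop_op,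
        Equiv.Perm.mul_apply, List.foldl_cons]
      rw [ih]
      rfl
  let f : Fin (2 * g) → (Equiv.Perm X)ᵐᵒᵖ := fun i => MulOpposite.op (P (i, true))
  have hrel : ∀ r ∈ ({relator g} : Set (FreeGroup (Fin (2*g)))), FreeGroup.lift f r = 1 := by
    intro r hr
    rw [Set.mem_singleton_iff] at hr
    subst hr
    have e1 : FreeGroup.lift f (relator g) =
        ((Rword g).map (fun a => MulOpposite.op (P a))).prod := by
      rw [relator, map_mul, map_list_prod, map_list_prod, Rword, List.map_append, List.prod_append,
        List.map_ofFn, List.map_ofFn, List.map_ofFn, List.map_ofFn]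
      congr 2
      · congr 1
        funext i
        simp only [Function.comp, map_inv, FreeGroup.lift_apply_of, f]
        rw [← MulOpposite.op_inv, ← hPinv]; rfl
    rw [e1]
    apply MulOpposite.unop_injective
    ext x
    rw [hfold]
    have : (Rword g).foldl (fun x a => step (pos a) x) x =
        ((Rword g).map pos).foldl (fun x a => step a x) x := by rw [List.foldl_map]
    rw [this, Rword_map_pos, List.foldl_map, h2]
    rfl
  let ψ := PresentedGroup.toGroup hrel
  have hψ : ∀ w : Word g, ψ (eval g w) = (w.map (fun a => MulOpposite.op (P a))).prod := by
    intro w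
    rw [eval, map_list_prod, List.map_map]
    congr 2
    funext a
    obtain ⟨i, e⟩ := a
    cases e
    · have : ψ (gen g i) = f i := PresentedGroup.toGroup.of hrel
      simp only [Function.comp, evalLetter]
      simp only [Bool.false_eq_true, if_false, map_inv, this, f]
      rw [← MulOpposite.op_inv, ← hPinv]; rfl
    · exact PresentedGroup.toGroup.of hrel
  rw [← hfold, ← hfold, ← hψ, ← hψ, huv]

/-- Invariance of foldings under the relations of the Coxeter group. -/
lemma W_inv {g : ℕ} {X : Type*} (step : ZMod (4 * g) → X → X)
    (h1 : ∀ a x, step a (step a x) = x)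
    (h2 : ∀ a b x, (b = a + 1 ∨ a = b + 1) → (fun x => step b (step a x))^[2 * g] x = x)
    (u v : List (ZMod (4 * g))) (huv : (csys g).wordProd u = (csys g).wordProd v) (x : X) :
    u.foldl (fun x a => step a x) x = v.foldl (fun x a => step a x) x := by
  let P : ZMod (4 * g) → Equiv.Perm X := fun a => ⟨step a, step a, h1 a, h1 a⟩
  have hfold : ∀ (w : List (ZMod (4 * g))) (x : X),
      (w.map (fun a => MulOpposite.op (P a))).prod.unop x =
        w.foldl (fun x a => step a x) x := by
    intro w
    induction w with
    | nil => intro x; simp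
    | cons a w ih =>
      intro x
      simp only [List.map_cons, List.prod_cons, MulOpposite.unop_mul, MulOpposite.unop_op,
        Equiv.Perm.mul_apply, List.foldl_cons]
      rw [ih]
      rfl
  let f : ZMod (4 * g) → (Equiv.Perm X)ᵐᵒᵖ := fun i => MulOpposite.op (P i)
  have hlift : (cmat g).IsLiftable f := by
    apply liftable_of
    · intro a
      apply MulOpposite.unop_injective
      ext x
      exact h1 a x
    · intro a b _ hab
      apply MulOpposite.unop_injective
      ext x
      have : (f a * f b) ^ (2 * g) = MulOpposite.op ((P b * P a) ^ (2 * g)) := by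
        rw [MulOpposite.op_pow, MulOpposite.op_mul]
      rw [this, MulOpposite.unop_op, Equiv.Perm.coe_pow]
      exact h2 a b x hab
  let ψ := (csys g).lift ⟨f, hlift⟩
  have hψ : ∀ w : List (ZMod (4 * g)), ψ ((csys g).wordProd w) =
      (w.map (fun a => MulOpposite.op (P a))).prod := by
    intro w
    rw [wordProd, map_list_prod, List.map_map]
    congr 2
  rw [← hfold, ← hfold, ← hψ, ← hψ, huv]

end SGP


namespace SGP
open CoxeterSystem SG

/-- Sign. -/
def sgn (g : ℕ) (e : Bool) : ZMod (4 * g) := if e then 1 else -1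

lemma sgn_not (g : ℕ) (e : Bool) : sgn g (!e) = - sgn g e := by
  cases e <;> simp [sgn]

lemma sgn_sq (g : ℕ) (e : Bool) : sgn g e * sgn g e = 1 := by
  cases e <;> simp [sgn]

/-- Affine state: identification of the star of a vertex with the standard one. -/
abbrev St (g : ℕ) := Bool × ZMod (4 * g)

/-- Label of the edge in direction `a`. -/
def lab {g : ℕ} (σ : St g) (a : ZMod (4 * g)) : ZMod (4 * g) := sgn g σ.1 * a + σ.2

/-- State after crossing in direction `a`. -/
def nxt {g : ℕ} (σ : St g) (a : ZMod (4 * g)) : St g :=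
  (!σ.1, σ.2 + sgn g σ.1 * (2 * a + hf g))

/-- Translation of words. -/
def theta {g : ℕ} (σ : St g) : Word g → List (ZMod (4 * g))
  | [] => []
  | a :: u => lab σ (pos a) :: theta (nxt σ (pos a)) u

/-- Final state. -/
def fin {g : ℕ} (σ : St g) (u : Word g) : St g := u.foldl (fun σ a => nxt σ (pos a)) σ

lemma theta_length {g : ℕ} (σ : St g) (u : Word g) : (theta σ u).length = u.length := by
  induction u generalizing σ with
  | nil => rfl
  | cons a u ih => simp [theta, ih]

lemma theta_append {g : ℕ} (σ : St g) (u v : Word g) :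
    theta σ (u ++ v) = theta σ u ++ theta (fin σ u) v := by
  induction u generalizing σ with
  | nil => rfl
  | cons a u ih => simp [theta, ih, fin]

lemma fin_append {g : ℕ} (σ : St g) (u v : Word g) : fin σ (u ++ v) = fin (fin σ u) v := by
  simp [fin]

lemma theta_take {g : ℕ} (σ : St g) (u : Word g) (k : ℕ) :
    theta σ (u.take k) = (theta σ u).take k := by
  induction u generalizing σ k with
  | nil => simp [theta]
  | cons a u ih =>
    cases k with
    | zero => simp [theta]
    | succ k => simp [theta, ih]

lemma theta_surj {g : ℕ} (hg : 2 ≤ g) (σ : St g) (ω : List (ZMod (4 * g))) :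
    ∃ u, theta σ u = ω := by
  induction ω generalizing σ with
  | nil => exact ⟨[], rfl⟩
  | cons c ω ih =>
    obtain ⟨a, ha⟩ := (pos_bij hg).2 (sgn g σ.1 * (c - σ.2))
    obtain ⟨u, hu⟩ := ih (nxt σ (pos a))
    refine ⟨a :: u, ?_⟩
    rw [theta, hu]
    congr 1
    rw [lab, ha]
    linear_combination (c - σ.2) * sgn_sq g σ.1

/-- Step on the Coxeter side. -/
def stepG {g : ℕ} (a : ZMod (4 * g)) (p : (cmat g).Group × St g) : (cmat g).Group × St g :=
  (p.1 * (csys g).simple (lab p.2 a), nxt p.2 a)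

lemma lab_nxt {g : ℕ} (σ : St g) (a : ZMod (4 * g)) : lab (nxt σ a) (a + hf g) = lab σ a := by
  simp only [lab, nxt, sgn_not]; ring

lemma nxt_nxt {g : ℕ} (σ : St g) (a : ZMod (4 * g)) : nxt (nxt σ a) (a + hf g) = σ := by
  obtain ⟨e, t⟩ := σ
  refine Prod.ext (by simp [nxt]) ?_
  simp only [nxt, sgn_not]
  linear_combination (- sgn g e) * hf2 g

lemma stepG_inv {g : ℕ} (a : ZMod (4 * g)) (p : (cmat g).Group × St g) :
    stepG (a + hf g) (stepG a p) = p := by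
  refine Prod.ext ?_ (nxt_nxt _ _)
  simp only [stepG, lab_nxt]
  exact (csys g).simple_mul_simple_cancel_right _

lemma stepG_fold {g : ℕ} (w : (cmat g).Group) (e : Bool) (t : ZMod (4 * g)) (m : ℕ) :
    (List.range (2 * m)).foldl (fun (x : (cmat g).Group × St g) (k : ℕ) =>
      stepG ((k : ZMod (4 * g)) * kap g) x) (w, (e, t)) =
      (w * ((csys g).simple t * (csys g).simple (t - sgn g e)) ^ m,
        (e, t - 2 * m * sgn g e)) := by
  induction m with
  | zero => simp
  | succ m ih =>
    rw [show 2 * (m + 1) = 2 * m + 1 + 1 by ring, List.range_succ, List.range_succ,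
      List.foldl_append, List.foldl_append, ih]
    simp only [List.foldl_cons, List.foldl_nil]
    have l1 : lab (e, t - 2 * (m : ZMod (4 * g)) * sgn g e) (((2 * m : ℕ) : ZMod (4 * g)) * kap g) = t := by
      simp only [lab, kap]
      push_cast
      linear_combination sgn g e * hf_even g m
    have l2 : lab (nxt (e, t - 2 * (m : ZMod (4 * g)) * sgn g e) (((2 * m : ℕ) : ZMod (4 * g)) * kap g))
        (((2 * m + 1 : ℕ) : ZMod (4 * g)) * kap g) = t - sgn g e := by
      simp only [lab, nxt, kap, sgn_not]
      push_cast
      linear_combination sgn g e * hf_even g m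
    have l3 : nxt (nxt (e, t - 2 * (m : ZMod (4 * g)) * sgn g e) (((2 * m : ℕ) : ZMod (4 * g)) * kap g))
        (((2 * m + 1 : ℕ) : ZMod (4 * g)) * kap g) = (e, t - 2 * (m + 1 : ℕ) * sgn g e) := by
      refine Prod.ext (by simp [nxt]) ?_
      simp only [nxt, kap, sgn_not]
      push_cast
      linear_combination (-sgn g e) * hf2 g
    simp only [stepG, l1, l2, l3]
    refine Prod.ext ?_ rfl
    rw [pow_succ]
    simp only [mul_assoc]

lemma stepG_rel {g : ℕ} (hg : 2 ≤ g) (p : (cmat g).Group × St g) :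
    (List.range (4 * g)).foldl (fun (x : (cmat g).Group × St g) (k : ℕ) =>
      stepG ((k : ZMod (4 * g)) * kap g) x) p = p := by
  obtain ⟨w, e, t⟩ := p
  have h := stepG_fold w e t (2 * g)
  rw [show 2 * (2 * g) = 4 * g by ring] at h
  rw [h]
  have hM : cmat g t (t - sgn g e) = 2 * g := by
    rw [cmat_apply, if_neg, if_pos]
    · cases e <;> simp [sgn]
    · intro h
      have h1 : (1 : ZMod (4 * g)) ≠ 0 := by
        simpa using zmod_ne_zero hg 1 (by norm_num) (by norm_num)
      cases e
      · simp [sgn, h1] at h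
      · simp only [sgn, if_true] at h
        exact h1 (by linear_combination h)
  have hp := (csys g).simple_mul_simple_pow t (t - sgn g e)
  rw [hM] at hp
  rw [hp]
  refine Prod.ext (by simp) (Prod.ext rfl ?_)
  have := ZMod.natCast_self (4 * g)
  push_cast at this ⊢
  linear_combination (-sgn g e) * this

lemma fold_stepG {g : ℕ} (u : Word g) (w : (cmat g).Group) (σ : St g) :
    u.foldl (fun x a => stepG (pos a) x) (w, σ) = (w * (csys g).wordProd (theta σ u), fin σ u) := by
  induction u generalizing w σ with
  | nil => simp [theta, fin]
  | cons a u ih =>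
    rw [List.foldl_cons, stepG, ih]
    simp only [theta, fin, wordProd_cons, List.foldl_cons, mul_assoc]

lemma G_to_W {g : ℕ} (hg : 2 ≤ g) {u v : Word g} (h : eval g u = eval g v) (σ : St g) :
    (csys g).wordProd (theta σ u) = (csys g).wordProd (theta σ v) ∧ fin σ u = fin σ v := by
  have := G_inv stepG stepG_inv (stepG_rel hg) u v h (1, σ)
  rw [fold_stepG, fold_stepG] at this
  simpa using this

/-- Letter at a position. -/
noncomputable def letAt {g : ℕ} (hg : 2 ≤ g) (a : ZMod (4 * g)) : Letter g :=
  (Equiv.ofBijective _ (pos_bij hg)).symm a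

lemma pos_letAt {g : ℕ} (hg : 2 ≤ g) (a : ZMod (4 * g)) : pos (letAt hg a) = a :=
  (Equiv.ofBijective _ (pos_bij hg)).apply_symm_apply a

lemma letAt_pos {g : ℕ} (hg : 2 ≤ g) (a : Letter g) : letAt hg (pos a) = a :=
  pos_inj (pos_letAt hg _)

/-- Group element at a position. -/
noncomputable def gAt {g : ℕ} (hg : 2 ≤ g) (a : ZMod (4 * g)) : SurfaceGroup g :=
  evalLetter g (letAt hg a)

lemma gAt_pos {g : ℕ} (hg : 2 ≤ g) (a : Letter g) : gAt hg (pos a) = evalLetter g a := by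
  rw [gAt, letAt_pos]

lemma gAt_hf {g : ℕ} (hg : 2 ≤ g) (a : ZMod (4 * g)) : gAt hg (a + hf g) = (gAt hg a)⁻¹ := by
  have : letAt hg (a + hf g) = invLetter g (letAt hg a) := by
    apply pos_inj
    rw [pos_inv, pos_letAt, pos_letAt]
  rw [gAt, this, evalLetter_inv, gAt]

/-- Products along (partial) relators. -/
noncomputable def relProd {g : ℕ} (hg : 2 ≤ g) (b d : ZMod (4 * g)) (m : ℕ) : SurfaceGroup g :=
  ((List.range m).map fun k : ℕ => gAt hg (b + k * d)).prod

lemma relProd_succ {g : ℕ} (hg : 2 ≤ g) (b d : ZMod (4 * g)) (m : ℕ) :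
    relProd hg b d (m + 1) = relProd hg b d m * gAt hg (b + m * d) := by
  simp [relProd, List.range_succ]

lemma relProd_succ' {g : ℕ} (hg : 2 ≤ g) (b d : ZMod (4 * g)) (m : ℕ) :
    relProd hg b d (m + 1) = gAt hg b * relProd hg (b + d) d m := by
  simp only [relProd, List.range_succ_eq_map, List.map_cons, List.map_map, List.prod_cons]
  congr 1
  · simp
  · congr 2
    funext k
    simp only [Function.comp]
    congr 1
    push_cast
    ring

lemma relProd_zero_kap {g : ℕ} (hg : 2 ≤ g) : relProd hg 0 (kap g) (4 * g) = 1 := by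
  rw [← eval_Rword g, eval]
  have h : (Rword g).map (evalLetter g) = ((Rword g).map pos).map (gAt hg) := by
    rw [List.map_map]
    apply List.map_congr_left
    intro a _
    exact (gAt_pos hg a).symm
  rw [h, Rword_map_pos, relProd, List.map_map]
  congr 2
  funext k
  simp

lemma relProd_shift {g : ℕ} (hg : 2 ≤ g) (b d : ZMod (4 * g))
    (h : relProd hg b d (4 * g) = 1) : relProd hg (b + d) d (4 * g) = 1 := by
  have h1 := relProd_succ hg b d (4 * g)
  rw [relProd_succ', h, one_mul] at h1
  have : ((4 * g : ℕ) : ZMod (4 * g)) = 0 := ZMod.natCast_self _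
  rw [this, zero_mul, add_zero] at h1
  simpa using h1

lemma relProd_kap {g : ℕ} (hg : 2 ≤ g) (b : ZMod (4 * g)) :
    relProd hg b (kap g) (4 * g) = 1 := by
  have key : ∀ m : ℕ, relProd hg (m * kap g) (kap g) (4 * g) = 1 := by
    intro m
    induction m with
    | zero => simpa using relProd_zero_kap hg
    | succ m ih =>
      have := relProd_shift hg _ _ ih
      push_cast
      rwa [add_mul, one_mul]
  have : NeZero (4 * g) := ⟨by omega⟩
  have h := key (b * kap g).val
  rw [ZMod.natCast_zmod_val, mul_assoc, kapsq, mul_one] at h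
  exact h

lemma relProd_neg {g : ℕ} (hg : 2 ≤ g) (b d : ZMod (4 * g)) (m : ℕ) :
    relProd hg b (-d) m * relProd hg (b + hf g - m * d + d) d m = 1 := by
  induction m with
  | zero => simp [relProd]
  | succ m ih =>
    rw [relProd_succ, relProd_succ']
    have e1 : b + hf g - ((m + 1 : ℕ) : ZMod (4 * g)) * d + d = (b + m * -d) + hf g := by
      push_cast; ring
    rw [e1, gAt_hf]
    have e2 : b + m * -d + hf g + d = b + hf g - m * d + d := by ring
    rw [e2]
    simpa [mul_assoc] using ih

lemma relProd_all {g : ℕ} (hg : 2 ≤ g) (b δ : ZMod (4 * g)) (hδ : δ = 1 ∨ δ = -1) :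
    relProd hg b (δ * kap g) (4 * g) = 1 := by
  rcases hδ with rfl | rfl
  · rw [one_mul]; exact relProd_kap hg b
  · have := relProd_neg hg b (kap g) (4 * g)
    rw [relProd_kap, mul_one] at this
    rw [neg_one_mul]; exact this

/-- Step on the surface group side. -/
noncomputable def stepW {g : ℕ} (hg : 2 ≤ g) (c : ZMod (4 * g)) (p : SurfaceGroup g × St g) :
    SurfaceGroup g × St g :=
  (p.1 * gAt hg (sgn g p.2.1 * (c - p.2.2)), nxt p.2 (sgn g p.2.1 * (c - p.2.2)))

lemma stepW_inv {g : ℕ} (hg : 2 ≤ g) (c : ZMod (4 * g)) (p : SurfaceGroup g × St g) :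
    stepW hg c (stepW hg c p) = p := by
  obtain ⟨z, e, t⟩ := p
  have key : sgn g (nxt (e, t) (sgn g e * (c - t))).1 * (c - (nxt (e, t) (sgn g e * (c - t))).2)
      = sgn g e * (c - t) + hf g := by
    simp only [nxt, sgn_not]
    linear_combination (2 * sgn g e * (c - t) + hf g) * sgn_sq g e
  simp only [stepW]
  rw [key, nxt_nxt, gAt_hf]
  simp

lemma stepW_iter {g : ℕ} (hg : 2 ≤ g) (z : SurfaceGroup g) (e : Bool) (t c η : ZMod (4 * g))
    (hη : η = 1 ∨ η = -1) (m : ℕ) :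
    (fun x => stepW hg (c + η) (stepW hg c x))^[m] (z, (e, t)) =
      (z * relProd hg (sgn g e * (c - t)) (-(sgn g e * η) * kap g) (2 * m),
        (e, t + 2 * m * η)) := by
  have hηh : η * hf g = hf g := by
    rcases hη with rfl | rfl
    · ring
    · linear_combination -hf2 g
  have heh : sgn g e * hf g = hf g := by
    cases e
    · simp only [sgn]; simp; linear_combination -hf2 g
    · simp [sgn]
  have hsq := sgn_sq g e
  have hev := hf_even g (m : ZMod (4 * g))
  induction m with
  | zero => simp [relProd]
  | succ m ih =>
    have hev := hf_even g (m : ZMod (4 * g))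
    rw [Function.iterate_succ_apply', ih (hf_even g _)]
    rw [show 2 * (m + 1) = 2 * m + 1 + 1 by ring, relProd_succ, relProd_succ]
    have l1 : sgn g e * (c - (t + 2 * m * η)) =
        sgn g e * (c - t) + ((2 * m : ℕ) : ZMod (4 * g)) * (-(sgn g e * η) * kap g) := by
      simp only [kap]; push_cast
      linear_combination (sgn g e * η) * hev
    set a := sgn g e * (c - (t + 2 * m * η)) with ha
    have l2 : sgn g (nxt (e, t + 2 * (m : ZMod (4 * g)) * η) a).1 * (c + η - (nxt (e, t + 2 * (m : ZMod (4 * g)) * η) a).2) =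
        sgn g e * (c - t) + ((2 * m + 1 : ℕ) : ZMod (4 * g)) * (-(sgn g e * η) * kap g) := by
      simp only [nxt, kap, sgn_not]; push_cast
      rw [ha]
      linear_combination (2 * sgn g e * (c - (t + 2 * m * η)) + hf g) * hsq +
        (sgn g e * η) * hev + sgn g e * hηh + heh + hf2 g
    have l3 : nxt (nxt (e, t + 2 * (m : ZMod (4 * g)) * η) a)
        (sgn g e * (c - t) + ((2 * m + 1 : ℕ) : ZMod (4 * g)) * (-(sgn g e * η) * kap g)) =
        (e, t + 2 * (m + 1 : ℕ) * η) := by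
      refine Prod.ext (by simp [nxt]) ?_
      simp only [nxt, kap, sgn_not]
      push_cast
      rw [ha]
      linear_combination (2 * η) * hsq + (2 * sgn g e * sgn g e * η) * hev + (η * sgn g e * sgn g e) * hf2 g
    simp only [stepW]
    rw [← ha, l2, l3, ← l1]
    refine Prod.ext ?_ rfl
    simp only [mul_assoc]

lemma stepW_rel {g : ℕ} (hg : 2 ≤ g) (a b : ZMod (4 * g)) (p : SurfaceGroup g × St g)
    (hab : b = a + 1 ∨ a = b + 1) :
    (fun x => stepW hg b (stepW hg a x))^[2 * g] p = p := by
  obtain ⟨z, e, t⟩ := p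
  obtain ⟨η, hη, rfl⟩ : ∃ η : ZMod (4 * g), (η = 1 ∨ η = -1) ∧ b = a + η := by
    rcases hab with h | h
    · exact ⟨1, Or.inl rfl, h⟩
    · exact ⟨-1, Or.inr rfl, by rw [h]; ring⟩
  rw [stepW_iter hg z e t a η hη, show 2 * (2 * g) = 4 * g by ring, relProd_all]
  · refine Prod.ext (by simp) (Prod.ext rfl ?_)
    have := ZMod.natCast_self (4 * g)
    push_cast at this ⊢
    linear_combination η * this
  · cases e <;> rcases hη with rfl | rfl <;> simp [sgn]

lemma fold_stepW {g : ℕ} (hg : 2 ≤ g) (u : Word g) (z : SurfaceGroup g) (σ : St g) :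
    (theta σ u).foldl (fun x c => stepW hg c x) (z, σ) = (z * eval g u, fin σ u) := by
  induction u generalizing z σ with
  | nil => simp [theta, fin, eval_nil]
  | cons a u ih =>
    have h : sgn g σ.1 * (lab σ (pos a) - σ.2) = pos a := by
      rw [lab]; linear_combination (pos a) * sgn_sq g σ.1
    rw [theta, List.foldl_cons, stepW, h, gAt_pos, ih, eval_cons, mul_assoc]
    rfl

lemma W_to_G {g : ℕ} (hg : 2 ≤ g) {u v : Word g} {σ : St g}
    (h : (csys g).wordProd (theta σ u) = (csys g).wordProd (theta σ v)) : eval g u = eval g v := by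
  have := W_inv (stepW hg) (stepW_inv hg) (fun a b x => stepW_rel hg a b x) _ _ h (1, σ)
  rw [fold_stepW, fold_stepW] at this
  simpa using congrArg Prod.fst this

/-- Geodesic words. -/
def Geo {g : ℕ} (u : Word g) : Prop := ∀ v, eval g v = eval g u → u.length ≤ v.length

lemma Geo.reduced {g : ℕ} (hg : 2 ≤ g) {u : Word g} (h : Geo u) (σ : St g) :
    (csys g).IsReduced (theta σ u) := by
  obtain ⟨ω, hω, he⟩ := (csys g).exists_isReduced ((csys g).wordProd (theta σ u))
  obtain ⟨v, rfl⟩ := theta_surj hg σ ω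
  have h1 := h v (W_to_G hg he).symm
  have h2 := hω.eq
  have h3 := (csys g).length_wordProd_le (theta σ u)
  rw [← he, theta_length] at h2
  rw [theta_length] at h3
  unfold CoxeterSystem.IsReduced
  rw [theta_length]
  omega

lemma core_G {g : ℕ} (hg : 2 ≤ g) (U V C : Word g) (b₁ b₂ y : Letter g) (δ : ZMod (4 * g))
    (hδ : δ = 1 ∨ δ = -1) (h2 : pos b₂ = pos b₁ + δ * kap g) (h3 : pos y = pos b₂ + δ * kap g)
    (heq : eval g (U ++ V) = eval g (C ++ [b₁, b₂]))
    (hU : Geo U) (hV : Geo (V ++ [y])) (hC : Geo (C ++ [b₁, b₂, y]))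
    (hlast : V.getLast? ≠ some b₂) : ∃ k, eval g (U.take k) = eval g (C ++ [b₁]) := by
  let σ : St g := (true, 0)
  obtain ⟨hW, hF⟩ := G_to_W hg heq σ
  set τ := fin σ C with hτ
  have hδh : δ * hf g = hf g := by
    rcases hδ with rfl | rfl
    · ring
    · linear_combination -hf2 g
  have heh : sgn g τ.1 * hf g = hf g := by
    cases τ.1
    · simp only [sgn]; simp; linear_combination -hf2 g
    · simp [sgn]
  set i := lab τ (pos b₁) with hi
  set j := lab (nxt τ (pos b₁)) (pos b₂) with hj
  have hi2 : lab (nxt (nxt τ (pos b₁)) (pos b₂)) (pos y) = i := by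
    rw [hi, h3, h2]
    simp only [lab, nxt, sgn_not, kap]
    ring
  have hij : i = j + sgn g τ.1 * δ := by
    rw [hi, hj, h2]
    simp only [lab, nxt, sgn_not, kap]
    linear_combination (sgn g τ.1) * hδh
  have hε : sgn g τ.1 * δ = 1 ∨ sgn g τ.1 * δ = -1 := by
    cases τ.1 <;> rcases hδ with rfl | rfl <;> simp [sgn]
  have tC : theta σ (C ++ [b₁, b₂, y]) = theta σ C ++ [i, j, i] := by
    rw [theta_append]
    simp only [theta, ← hτ, ← hi, ← hj, hi2]
  have tC2 : theta σ (C ++ [b₁, b₂]) = theta σ C ++ [i, j] := by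
    rw [theta_append]
    simp only [theta, ← hτ, ← hi, ← hj]
  have tC1 : theta σ (C ++ [b₁]) = theta σ C ++ [i] := by
    rw [theta_append]
    simp only [theta, ← hτ, ← hi]
  have hfC : fin σ (C ++ [b₁, b₂]) = nxt (nxt τ (pos b₁)) (pos b₂) := by
    rw [fin_append]; rfl
  have hfUV : fin (fin σ U) V = nxt (nxt τ (pos b₁)) (pos b₂) := by
    rw [← fin_append, hF, hfC]
  have tV : theta (fin σ U) (V ++ [y]) = theta (fin σ U) V ++ [i] := by
    rw [theta_append]
    simp only [theta, hfUV, hi2]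
  rw [theta_append, wordProd_append, tC2] at hW
  have hCr := hC.reduced hg σ
  rw [tC] at hCr
  have hVr := hV.reduced hg (fin σ U)
  rw [tV] at hVr
  obtain ⟨k, hk⟩ := core_W hg hε hij (theta σ C) (theta σ U) (theta (fin σ U) V) hCr
    (hU.reduced hg σ) hVr hW (by
      rcases List.eq_nil_or_concat V with rfl | ⟨V', v, rfl⟩
      · simp [theta]
      · intro h
        rw [List.concat_eq_append] at *
        rw [theta_append] at h
        rw [fin_append] at hfUV
        simp only [theta, List.getLast?_append, List.getLast?_singleton, Option.some_or,
          Option.some.injEq] at h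
        simp only [List.getLast?_append, List.getLast?_singleton, Option.some_or, ne_eq,
          Option.some.injEq] at hlast
        apply hlast
        apply pos_inj
        set ρ := fin (fin σ U) V' with hρ
        have hfu : nxt ρ (pos v) = nxt (nxt τ (pos b₁)) (pos b₂) := hfUV
        have key : ∀ (ρ : St g) (a : ZMod (4 * g)),
            lab ρ a = (nxt ρ a).2 + sgn g (nxt ρ a).1 * (a + hf g) := by
          intro ρ a
          simp only [lab, nxt, sgn_not]; ring
        rw [hj, key ρ, key (nxt τ (pos b₁)), hfu] at h
        generalize nxt (nxt τ (pos b₁)) (pos b₂) = ν at h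
        linear_combination (sgn g ν.1) * h - (pos v - pos b₂) * sgn_sq g ν.1)
  rw [← tC1, ← theta_take] at hk
  exact ⟨k, W_to_G hg hk⟩

end SGP


namespace SGP
open SG

variable {g : ℕ}

lemma rank_inj : Function.Injective (rank g) := by
  rintro ⟨i, e⟩ ⟨j, e'⟩ h
  have hi := i.2
  have hj := j.2
  cases e <;> cases e' <;> simp [rank] at h ⊢ <;> omega

instance letterTri : Std.Trichotomous (letterLt g) :=
  ⟨fun a b h1 h2 => rank_inj (by unfold letterLt at h1 h2; omega)⟩

instance letterAsymm : Std.Asymm (letterLt g) :=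
  ⟨fun a b h1 h2 => by unfold letterLt at h1 h2; omega⟩

lemma wordLt_iff (X Y : Word g) : wordLt g X Y ↔ List.Shortlex (letterLt g) X Y :=
  List.shortlex_def.symm

lemma wordLt_asymm {X Y : Word g} (h : wordLt g X Y) : ¬ wordLt g Y X := by
  rw [wordLt_iff] at *
  exact Std.Asymm.asymm _ _ h

lemma wordLt_irrefl (X : Word g) : ¬ wordLt g X X := fun h => wordLt_asymm h h

lemma wordLt_tri (X Y : Word g) : wordLt g X Y ∨ X = Y ∨ wordLt g Y X := by
  by_contra! h
  obtain ⟨h1, h2, h3⟩ := h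
  rw [wordLt_iff] at h1 h3
  exact h2 (Std.Trichotomous.trichotomous _ _ h1 h3)

lemma letterLt_wf : WellFounded (letterLt g) := (measure (rank g)).wf

lemma wordLt_wf : WellFounded (wordLt g) := by
  have h : wordLt g = List.Shortlex (letterLt g) := by
    funext X Y; exact propext (wordLt_iff X Y)
  rw [h]
  exact List.Shortlex.wf letterLt_wf

lemma exists_irr (w : Word g) : ∃ W : Word g, eval g W = eval g w ∧ IrreducibleWord g W := by
  have hne : ({W | eval g W = eval g w} : Set (Word g)).Nonempty := ⟨w, rfl⟩
  refine ⟨wordLt_wf.min _ hne, wordLt_wf.min_mem _ hne, ?_⟩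
  intro W' hW'
  have h1 : eval g (wordLt_wf.min _ hne) = eval g w := wordLt_wf.min_mem _ hne
  have h2 := wordLt_wf.not_lt_min _ (x := W') (show W' ∈ {W | eval g W = eval g w} from hW'.trans h1)
  rcases wordLt_tri W' (wordLt_wf.min _ hne) with h | h | h
  · exact absurd h h2
  · exact Or.inl h
  · exact Or.inr h

lemma nf_spec (w : Word g) :
    eval g (nf g (eval g w)) = eval g w ∧ IrreducibleWord g (nf g (eval g w)) := by
  have h := exists_irr w
  unfold nf
  simp only [dif_pos h]
  exact h.choose_spec

lemma irr_unique {X Y : Word g} (hX : IrreducibleWord g X) (hY : IrreducibleWord g Y)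
    (h : eval g X = eval g Y) : X = Y := by
  rcases hX Y h.symm with h1 | h1
  · exact h1.symm
  · rcases hY X h with h2 | h2
    · exact h2
    · exact absurd h2 (wordLt_asymm h1)

lemma irr_geo {X : Word g} (hX : IrreducibleWord g X) : Geo X := by
  intro v hv
  rcases hX v hv with h | h | h
  · rw [h]
  · exact h.le
  · exact h.1.le

lemma lex_append {r : Letter g → Letter g → Prop} {X Y : Word g} (A : Word g)
    (hl : X.length = Y.length) (h : List.Lex r X Y) : List.Lex r (X ++ A) (Y ++ A) := by
  induction h with
  | nil => simp at hl
  | cons _ ih => exact List.Lex.cons (ih (by simpa using hl))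
  | rel h => exact List.Lex.rel h

lemma wordLt_factor {X Y : Word g} (A B : Word g) (h : wordLt g X Y) :
    wordLt g (A ++ X ++ B) (A ++ Y ++ B) := by
  rcases h with h | ⟨hl, h⟩
  · left; simp; omega
  · right
    refine ⟨by simp [hl], lex_append B (by simp [hl]) ?_⟩
    induction A with
    | nil => exact h
    | cons a A ih => exact List.Lex.cons ih

lemma irr_factor {A X B : Word g} (h : IrreducibleWord g (A ++ X ++ B)) :
    IrreducibleWord g X := by
  intro X' hX'
  rcases wordLt_tri X' X with h1 | h1 | h1
  · exfalso
    have h2 := wordLt_factor A B h1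
    rcases h (A ++ X' ++ B) (by simp only [eval_append, hX']) with h3 | h3
    · rw [h3] at h2; exact wordLt_irrefl _ h2
    · exact wordLt_asymm h2 h3
  · exact Or.inl h1
  · exact Or.inr h1

lemma relSeq_pos (hg : 2 ≤ g) {b : ℕ → Letter g} (hb : RelSeq g b) :
    ∃ δ : ZMod (4 * g), (δ = 1 ∨ δ = -1) ∧
      ∀ j, 1 ≤ j → j + 1 ≤ 4 * g → pos (b (j + 1)) = pos (b j) + δ * kap g := by
  have key : ∀ (L : Word g) (f : ℕ → ZMod (4 * g)) (n : ℕ),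
      L.map pos = (List.range (4 * g)).map f → L.rotate n = seg g b 1 (4 * g) →
      ∀ j, j < 4 * g → pos (b (1 + j)) = f ((j + n) % (4 * g)) := by
    intro L f n hL hr j hj
    have h1 := congrArg (List.map pos) hr
    rw [List.map_rotate, hL] at h1
    have h2 := congrArg (fun l => l[j]?) h1
    simp only [seg] at h2
    rw [List.getElem?_rotate (by simpa using hj)] at h2
    simp [hj, Nat.mod_lt _ (show 0 < 4 * g by omega)] at h2
    exact h2.symm
  have cm : ∀ m : ℕ, ((m % (4 * g) : ℕ) : ZMod (4 * g)) = (m : ZMod (4 * g)) := fun m => by simp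
  rcases hb.2 with ⟨n, hn⟩ | ⟨n, hn⟩
  · refine ⟨1, Or.inl rfl, fun j h1 h2 => ?_⟩
    have e := key _ _ n (Rword_map_pos g) hn
    obtain ⟨j, rfl⟩ : ∃ i, j = 1 + i := ⟨j - 1, by omega⟩
    have e1 := e j (by omega)
    have e2 := e (j + 1) (by omega)
    rw [cm] at e1 e2
    rw [e1, show 1 + j + 1 = 1 + (j + 1) by ring, e2]
    push_cast; ring
  · refine ⟨-1, Or.inr rfl, fun j h1 h2 => ?_⟩
    have hm : (wordInv g (Rword g)).map pos = (List.range (4 * g)).map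
        fun k : ℕ => (-1 - (k : ZMod (4 * g))) * kap g + hf g := by
      have h3 : (wordInv g (Rword g)).map pos
          = (((Rword g).map pos).map (fun x => x + hf g)).reverse := by
        unfold wordInv
        rw [List.map_reverse, List.map_map, List.map_map]
        congr 1
        apply List.map_congr_left
        intro a _
        exact pos_inv a
      rw [h3, Rword_map_pos]
      apply List.ext_getElem
      · simp
      · intro i hi hi'
        simp at hi'
        simp
        rw [Nat.sub_sub, Nat.cast_sub (by omega)]
        have := ZMod.natCast_self (4 * g)
        push_cast at this ⊢
        linear_combination (kap g) * this
    have e := key _ _ n hm hn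
    obtain ⟨j, rfl⟩ : ∃ i, j = 1 + i := ⟨j - 1, by omega⟩
    have e1 := e j (by omega)
    have e2 := e (j + 1) (by omega)
    rw [cm] at e1 e2
    rw [e1, show 1 + j + 1 = 1 + (j + 1) by ring, e2]
    push_cast; ring

lemma eval_wordInv (w : Word g) : eval g (wordInv g w) = (eval g w)⁻¹ := by
  induction w with
  | nil => simp [wordInv, eval]
  | cons a w ih =>
    have : wordInv g (a :: w) = wordInv g w ++ [invLetter g a] := by simp [wordInv]
    rw [this, eval_append, ih]
    simp [eval, evalLetter_inv]

lemma invLetter_inv (a : Letter g) : invLetter g (invLetter g a) = a := by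
  simp [invLetter]

lemma wordInv_inv (w : Word g) : wordInv g (wordInv g w) = w := by
  simp only [wordInv, List.map_reverse, List.reverse_reverse, List.map_map]
  conv_rhs => rw [← List.map_id w]
  apply List.map_congr_left
  intro a _
  exact invLetter_inv a

lemma wordInv_append (u v : Word g) : wordInv g (u ++ v) = wordInv g v ++ wordInv g u := by
  simp [wordInv]

lemma wordInv_length (u : Word g) : (wordInv g u).length = u.length := by
  simp [wordInv]

lemma geo_inv {u : Word g} (h : Geo u) : Geo (wordInv g u) := by
  intro v hv
  have := h (wordInv g v) (by rw [eval_wordInv, hv, eval_wordInv, inv_inv])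
  rwa [wordInv_length] at *

lemma rs_short {W₁ W₂ C₁ C₂ D₁ D₂ : Word g} (h : IsRS g W₁ W₂ C₁ C₂)
    (hD : IsRSCand g W₁ W₂ D₁ D₂)
    (hl : D₁.length < C₁.length ∨ (D₁ = C₁ ∧ D₂.length < C₂.length)) : False := by
  rcases h.2 D₁ D₂ hD with ⟨h1, h2⟩ | h1 | ⟨h1, h2⟩
  · subst h1 h2; omega
  · rcases hl with hl | ⟨hl, _⟩
    · rcases h1 with h1 | h1
      · simp at h1; omega
      · simp at h1; omega
    · subst hl; exact wordLt_irrefl _ h1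
  · simp only at h1 h2
    subst h1
    rcases hl with hl | ⟨_, hl⟩
    · omega
    · rcases h2 with h2 | h2 <;> omega

theorem rs_main (g : ℕ) (hg : 2 ≤ g) (U₁ U₂ V₁ V₂ : SG.Word g)
    (hU : SG.IrreducibleWord g (U₁ ++ U₂)) (hV : SG.IrreducibleWord g (V₁ ++ V₂))
    (hrs : SG.IsRS g (U₁ ++ U₂) (V₁ ++ V₂) U₂ V₁) :
    (∀ b : ℕ → SG.Letter g, SG.RelSeq g b → ∀ s : ℕ, 2 ≤ s → s ≤ 2*g →
      ∀ X : SG.Word g, SG.nf g (SG.eval g (U₂ ++ V₁)) = X ++ SG.seg g b 1 s →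
        V₂.head? ≠ some (b (s+1))) ∧
    (∀ b : ℕ → SG.Letter g, SG.RelSeq g b → ∀ s : ℕ, 2 ≤ s → s ≤ 2*g →
      ∀ X : SG.Word g, SG.nf g (SG.eval g (U₂ ++ V₁)) = SG.dseg g b s s ++ X →
        U₁.getLast? ≠ some (b (s+1))) := by
  obtain ⟨A, B, C', hA, hB, hC⟩ := hrs.1
  have hA' := List.append_cancel_right hA
  have hB' := List.append_cancel_left hB
  subst hA' hB'
  obtain ⟨hn1, hn2⟩ := nf_spec ((U₁ ++ U₂) ++ (V₁ ++ V₂))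
  rw [hC] at hn1 hn2
  have hCe : eval g C' = eval g (U₂ ++ V₁) := by
    simp only [eval_append] at hn1 ⊢
    have := hn1
    rw [show eval g U₁ * eval g U₂ * (eval g V₁ * eval g V₂)
      = eval g U₁ * (eval g U₂ * eval g V₁) * eval g V₂ by group] at this
    exact mul_left_cancel (mul_right_cancel this)
  have hCi : IrreducibleWord g C' := irr_factor hn2
  have hCn : nf g (eval g (U₂ ++ V₁)) = C' :=
    irr_unique (nf_spec _).2 hCi ((nf_spec _).1.trans hCe.symm)
  have hU2i : IrreducibleWord g U₂ := irr_factor (A := U₁) (B := []) (by simpa using hU)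
  have hV1i : IrreducibleWord g V₁ := irr_factor (A := []) (B := V₂) (by simpa using hV)
  rw [hCn]
  constructor
  · intro b hb s hs hs' X hX hy
    obtain ⟨δ, hδ, hp⟩ := relSeq_pos hg hb
    obtain ⟨t, rfl⟩ : ∃ t, s = t + 2 := ⟨s - 2, by omega⟩
    have p1 := hp (t + 1) (by omega) (by omega)
    have p2 := hp (t + 2) (by omega) (by omega)
    obtain ⟨C, hCC⟩ : ∃ C, C' = C ++ [b (t + 1), b (t + 2)] := by
      refine ⟨X ++ seg g b 1 t, ?_⟩
      rw [hX]
      simp [seg, List.range_succ, show 1 + t = t + 1 by ring, show 1 + (t + 1) = t + 2 by ring]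
    generalize b (t + 1) = b₁ at *
    generalize b (t + 1 + 1) = b₂ at *
    generalize b (t + 2 + 1) = y at *
    obtain ⟨V3, rfl⟩ : ∃ V3, V₂ = y :: V3 := by
      cases V₂ with
      | nil => simp at hy
      | cons a l => simp at hy; exact ⟨l, by rw [hy]⟩
    subst hCC
    have hlast : V₁.getLast? ≠ some b₂ := by
      intro hl
      obtain ⟨Z, rfl⟩ := List.getLast?_eq_some_iff.1 hl
      refine rs_short (D₁ := U₂) (D₂ := Z) hrs
        ⟨U₁, b₂ :: y :: V3, C ++ [b₁], rfl, by simp, by rw [hC]; simp⟩ (Or.inr ⟨rfl, by simp⟩)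
    obtain ⟨k, hk⟩ := core_G hg U₂ V₁ C b₁ b₂ y δ hδ p1 p2 hCe.symm (irr_geo hU2i)
      (irr_geo (irr_factor (A := []) (B := V3) (by simpa using hV)))
      (irr_geo (irr_factor (A := U₁) (B := V3) (by simpa using hn2))) hlast
    have hk' : U₂.take k = C ++ [b₁] := by
      refine irr_unique (irr_factor (A := []) (B := U₂.drop k) (by simpa using hU2i))
        (irr_factor (A := []) (B := [b₂]) (by simpa using hCi)) hk
    have hsp : U₂ = (C ++ [b₁]) ++ U₂.drop k := by
      rw [← hk', List.take_append_drop]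
    refine rs_short (D₁ := U₂.drop k) (D₂ := V₁) hrs
        ⟨U₁ ++ C ++ [b₁], y :: V3, [b₂], ?_, rfl, by rw [hC]; simp⟩ (Or.inl ?_)
    · conv_lhs => rw [hsp]
      simp
    · conv_rhs => rw [hsp]
      simp
      omega
  · intro b hb s hs hs' X hX hy
    obtain ⟨δ, hδ, hp⟩ := relSeq_pos hg hb
    obtain ⟨t, rfl⟩ : ∃ t, s = t + 2 := ⟨s - 2, by omega⟩
    have p1 := hp (t + 1) (by omega) (by omega)
    have p2 := hp (t + 2) (by omega) (by omega)
    obtain ⟨C, hCC⟩ : ∃ C, C' = b (t + 2) :: b (t + 1) :: C := by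
      refine ⟨((List.range t).map fun j => b (t + 2 + 4 * g - (j + 2))) ++ X, ?_⟩
      rw [hX]
      have e1 : b (t + 2 + 4 * g) = b (t + 2) := hb.1 _
      simp [dseg, List.range_succ_eq_map, e1, hb.1 (t + 1), Function.comp_def]
    generalize b (t + 1) = b₁ at *
    generalize b (t + 1 + 1) = b₂ at *
    generalize b (t + 2 + 1) = y at *
    obtain ⟨U3, rfl⟩ := List.getLast?_eq_some_iff.1 hy
    subst hCC
    have hhead : (wordInv g U₂).getLast? ≠ some (invLetter g b₂) := by
      intro hl
      obtain ⟨Z, hZ⟩ := List.getLast?_eq_some_iff.1 hl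
      have hZ' := congrArg (wordInv g) hZ
      rw [wordInv_inv, wordInv_append] at hZ'
      have hZ2 : U₂ = b₂ :: wordInv g Z := by
        rw [hZ']; simp [wordInv, invLetter_inv]
      refine rs_short (D₁ := wordInv g Z) (D₂ := V₁) hrs
        ⟨U3 ++ [y] ++ [b₂], V₂, b₁ :: C, ?_, rfl, by rw [hC]; simp⟩ (Or.inl ?_)
      · rw [hZ2]; simp
      · rw [hZ2]; simp
    obtain ⟨k, hk⟩ := core_G hg (wordInv g V₁) (wordInv g U₂) (wordInv g C)
      (invLetter g b₁) (invLetter g b₂) (invLetter g y) δ hδ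
      (by rw [pos_inv, pos_inv, p1]; ring) (by rw [pos_inv, pos_inv, p2]; ring)
      (by
        have h1 : wordInv g C ++ [invLetter g b₁, invLetter g b₂]
            = wordInv g (b₂ :: b₁ :: C) := by simp [wordInv]
        rw [h1, ← wordInv_append, eval_wordInv, eval_wordInv, hCe])
      (geo_inv (irr_geo hV1i))
      (by
        have h1 : wordInv g U₂ ++ [invLetter g y] = wordInv g (y :: U₂) := by simp [wordInv]
        rw [h1]
        exact geo_inv (irr_geo (irr_factor (A := U3) (B := []) (by simpa using hU))))
      (by
        have h1 : wordInv g C ++ [invLetter g b₁, invLetter g b₂, invLetter g y]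
            = wordInv g (y :: b₂ :: b₁ :: C) := by simp [wordInv]
        rw [h1]
        exact geo_inv (irr_geo (irr_factor (A := U3) (B := V₂) (by simpa using hn2)))) hhead
    obtain ⟨Z, T, hZT, hT⟩ : ∃ Z T, V₁ = Z ++ T ∧ eval g T = eval g (b₁ :: C) := by
      refine ⟨wordInv g ((wordInv g V₁).drop k), wordInv g ((wordInv g V₁).take k), ?_, ?_⟩
      · rw [← wordInv_append, List.take_append_drop, wordInv_inv]
      · rw [eval_wordInv, hk, ← eval_wordInv]
        congr 1
        rw [wordInv_append, wordInv_inv]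
        simp [wordInv, invLetter_inv]
    have hT' : T = b₁ :: C := by
      refine irr_unique (irr_factor (A := Z) (B := []) (by simpa [← hZT] using hV1i))
        (irr_factor (A := [b₂]) (B := []) (by simpa using hCi)) hT
    subst hT'
    refine rs_short (D₁ := U₂) (D₂ := Z) hrs
        ⟨U3 ++ [y], b₁ :: C ++ V₂, [b₂], rfl, by rw [hZT]; simp, by rw [hC]; simp⟩
        (Or.inr ⟨rfl, ?_⟩)
    rw [hZT]; simp

end SGP

/-- Under `rs(U,V) = (U₂,V₁)`: if `nf(U₂V₁) = X b₁⋯b_s`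
(`2 ≤ s ≤ 2g`, `b₁⋯b_{4g} ∈ 𝓡`) then `V₂` does not begin with `b_{s+1}`;
symmetrically if `nf(U₂V₁) = b_s⋯b₁X` then `U₁` does not end with `b_{s+1}`. -/
theorem rs_no_extension (g : ℕ) (hg : 2 ≤ g) (U₁ U₂ V₁ V₂ : SG.Word g)
    (hU : SG.IrreducibleWord g (U₁ ++ U₂)) (hV : SG.IrreducibleWord g (V₁ ++ V₂))
    (hfr : SG.FreelyReduced g ((U₁ ++ U₂) ++ (V₁ ++ V₂)))
    (hrs : SG.IsRS g (U₁ ++ U₂) (V₁ ++ V₂) U₂ V₁) :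
    (∀ b : ℕ → SG.Letter g, SG.RelSeq g b → ∀ s : ℕ, 2 ≤ s → s ≤ 2*g →
      ∀ X : SG.Word g, SG.nf g (SG.eval g (U₂ ++ V₁)) = X ++ SG.seg g b 1 s →
        V₂.head? ≠ some (b (s+1))) ∧
    (∀ b : ℕ → SG.Letter g, SG.RelSeq g b → ∀ s : ℕ, 2 ≤ s → s ≤ 2*g →
      ∀ X : SG.Word g, SG.nf g (SG.eval g (U₂ ++ V₁)) = SG.dseg g b s s ++ X →
        U₁.getLast? ≠ some (b (s+1))) := by
  exact SGP.rs_main g hg U₁ U₂ V₁ V₂ hU hV hrs
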